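/- For every θ ∈ (0, π/3) and ν_θ-almost every a ∈ Δ_θ, the box dimension of the slice E_{θ,a} exists and equals s − dim_H ν_θ, and this value is ≥ s − 1. -/

import Mathlib

open Filter MeasureTheory Set Metric Topology
open scoped ENNReal Classical

noncomputable section

/-- The maps of the iterated function system of the usual Sierpiński gasket. -/
def gasketMap : Fin 3 → ℝ × ℝ → ℝ × ℝ
  | 0 => fun z => (z.1 / 2, z.2 / 2)
  | 1 => fun z => (z.1 / 2 + 1 / 2, z.2 / 2)
  | 2 => fun z => (z.1 / 2 + 1 / 4, z.2 / 2 + Real.sqrt 3 / 4)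

/-- `Δ` is the Sierpiński gasket: the unique nonempty compact set invariant under the IFS. -/
def IsSierpinskiGasket (Δ : Set (ℝ × ℝ)) : Prop :=
  Δ.Nonempty ∧ IsCompact Δ ∧
    Δ = gasketMap 0 '' Δ ∪ gasketMap 1 '' Δ ∪ gasketMap 2 '' Δ

/-- The orthogonal projection onto the line through the origin making angle `θ` with the
`x`-axis, expressed as the real coordinate along that line. -/
def projAngle (θ : ℝ) (z : ℝ × ℝ) : ℝ := z.1 * Real.cos θ + z.2 * Real.sin θ

/-- The slice `E_{θ,a}`. -/
def sliceSet (Δ : Set (ℝ × ℝ)) (θ a : ℝ) : Set (ℝ × ℝ) :=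
  {z ∈ Δ | projAngle θ z = a}

/-- Minimal number of `ε`-balls needed to cover `E` (junk value `0` if there is no
finite cover). -/
def coverNum {X : Type*} [PseudoMetricSpace X] (E : Set X) (ε : ℝ) : ℕ :=
  sInf {n : ℕ | ∃ F : Finset X, F.card = n ∧ E ⊆ ⋃ x ∈ F, Metric.ball x ε}

/-- Lower box (Minkowski) dimension. -/
def lowerBoxDim {X : Type*} [PseudoMetricSpace X] (E : Set X) : ℝ :=
  liminf (fun ε : ℝ => Real.log (coverNum E ε) / Real.log (1 / ε)) (𝓝[>] 0)

/-- Upper box (Minkowski) dimension. -/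
def upperBoxDim {X : Type*} [PseudoMetricSpace X] (E : Set X) : ℝ :=
  limsup (fun ε : ℝ => Real.log (coverNum E ε) / Real.log (1 / ε)) (𝓝[>] 0)

/-- Lower local dimension of a measure at a point. -/
def lowerLocalDim (η : Measure ℝ) (x : ℝ) : ℝ :=
  liminf (fun r : ℝ => Real.log (η (Metric.ball x r)).toReal / Real.log r) (𝓝[>] 0)

/-- Upper local dimension of a measure at a point. -/
def upperLocalDim (η : Measure ℝ) (x : ℝ) : ℝ :=
  limsup (fun r : ℝ => Real.log (η (Metric.ball x r)).toReal / Real.log r) (𝓝[>] 0)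

/-- `ν` is the natural self-similar measure on the Sierpiński gasket `Δ`, i.e. the unique
Borel probability measure with `ν = Σ_{i=0}^2 (1/3) ν ∘ S_i⁻¹` (supported on `Δ`). -/
def IsGasketMeasure (Δ : Set (ℝ × ℝ)) (ν : Measure (ℝ × ℝ)) : Prop :=
  IsProbabilityMeasure ν ∧ ν Δᶜ = 0 ∧
    ν = (3 : ℝ≥0∞)⁻¹ • (ν.map (gasketMap 0) + ν.map (gasketMap 1) + ν.map (gasketMap 2))

/-- Hausdorff dimension of a measure: `inf {dim_H A : η A = 1}`. -/
def measureDimH (η : Measure ℝ) : ℝ≥0∞ :=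
  sInf {d : ℝ≥0∞ | ∃ A : Set ℝ, η A = 1 ∧ dimH A = d}

/-- The matrices `A_0, A_1` of the paper (there rows and columns are indexed by
`1, …, p+q`; here `i : Fin (p+q)` corresponds to the row `i+1`). -/
def gmA (p q : ℕ) (n : ℕ) : Matrix (Fin (p + q)) (Fin (p + q)) ℝ :=
  Matrix.of fun i j =>
    if Int.ModEq ((p : ℤ) + (q : ℤ)) (2 * ((i : ℤ) + 1) + 1 - (n : ℤ)) ((j : ℤ) + 1) ∨
        (((q : ℤ) + 1 ≤ 2 * ((i : ℤ) + 1) + (n : ℤ) - 1 ∧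
            2 * ((i : ℤ) + 1) + (n : ℤ) - 1 ≤ 2 * (q : ℤ) + (p : ℤ)) ∧
          Int.ModEq ((p : ℤ) + (q : ℤ)) (2 * ((i : ℤ) + 1) + 1 - (n : ℤ) - (q : ℤ))
            ((j : ℤ) + 1))
    then 1 else 0

/-- The product `A_{ξ_1} ⋯ A_{ξ_n}` along a word `ξ ∈ {0,1}^n`. -/
def gmProd (p q : ℕ) {n : ℕ} (ξ : Fin n → Fin 2) : Matrix (Fin (p + q)) (Fin (p + q)) ℝ :=
  (List.ofFn fun m => gmA p q (ξ m : ℕ)).prod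

/-- `e ⬝ A_{ξ_1} ⋯ A_{ξ_n} ⬝ e` where `e = (1,…,1)`. -/
def eAe (p q : ℕ) {n : ℕ} (ξ : Fin n → Fin 2) : ℝ :=
  ∑ i : Fin (p + q), ∑ j : Fin (p + q), gmProd p q ξ i j

/-- `e_k ⬝ A_{ξ_1} ⋯ A_{ξ_n} ⬝ e` where `e_k` is the `k`-th standard basis vector. -/
def ekAe (p q : ℕ) {n : ℕ} (k : Fin (p + q)) (ξ : Fin n → Fin 2) : ℝ :=
  ∑ j : Fin (p + q), gmProd p q ξ k j

/-- The maps of the IFS of the right-angle Sierpiński gasket. -/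
def rgasketMap : Fin 3 → ℝ × ℝ → ℝ × ℝ
  | 0 => fun z => (z.1 / 2, z.2 / 2)
  | 1 => fun z => (z.1 / 2 + 1 / 2, z.2 / 2)
  | 2 => fun z => (z.1 / 2, z.2 / 2 + 1 / 2)

/-- `Λ` is the right-angle Sierpiński gasket. -/
def IsRightGasket (Λ : Set (ℝ × ℝ)) : Prop :=
  Λ.Nonempty ∧ IsCompact Λ ∧
    Λ = rgasketMap 0 '' Λ ∪ rgasketMap 1 '' Λ ∪ rgasketMap 2 '' Λ

/-- The slice of the right-angle gasket by the line `y = a + (p/q) x`. -/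
def rslice (Λ : Set (ℝ × ℝ)) (p q : ℕ) (a : ℝ) : Set (ℝ × ℝ) :=
  {z ∈ Λ | z.2 = a + ((p : ℝ) / (q : ℝ)) * z.1}

/-- The cylinder set `Δ_{i_1 ⋯ i_n} = S_{i_1} ∘ ⋯ ∘ S_{i_n}(Δ)`. -/
def cylSet (Δ : Set (ℝ × ℝ)) {n : ℕ} (w : Fin n → Fin 3) : Set (ℝ × ℝ) :=
  (List.ofFn fun m => gasketMap (w m)).foldr (fun f E => f '' E) Δ

/-- A linear-growth criterion: `u n / n → l` if `u` and `-u` are eventually almost bounded by the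
corresponding linear functions. -/
lemma tendsto_div_natCast_of_eventually_le {u : ℕ → ℝ} {l : ℝ}
    (h1 : ∀ k : ℕ, ∀ᶠ n : ℕ in atTop, u n ≤ n * (l + 1 / (k + 1 : ℝ)))
    (h2 : ∀ k : ℕ, ∀ᶠ n : ℕ in atTop, -u n ≤ n * (-l + 1 / (k + 1 : ℝ))) :
    Tendsto (fun n : ℕ => u n / n) atTop (𝓝 l) := by
  rw [Metric.tendsto_nhds]
  intro ε hε
  obtain ⟨k, hk⟩ := exists_nat_one_div_lt hε
  filter_upwards [h1 k, h2 k, eventually_gt_atTop 0] with n a1 a2 hn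
  have hn' : (0 : ℝ) < n := by exact_mod_cast hn
  rw [Real.dist_eq, abs_lt]
  have b1 : u n / n ≤ l + 1 / (k + 1 : ℝ) := by
    rw [div_le_iff₀ hn']; linarith
  have b2 : l - 1 / (k + 1 : ℝ) ≤ u n / n := by
    rw [le_div_iff₀ hn']; linarith
  constructor <;> linarith

section Birkhoff

variable {Ω : Type*} {T : Ω → Ω}

/-- The running maximum of the Birkhoff sums `S_0, …, S_n`. -/
def birkhoffMax (T : Ω → Ω) (f : Ω → ℝ) : ℕ → Ω → ℝ
  | 0 => 0
  | n + 1 => fun ω => max 0 (f ω + birkhoffMax T f n (T ω))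

lemma birkhoffMax_nonneg (f : Ω → ℝ) (n : ℕ) (ω : Ω) : 0 ≤ birkhoffMax T f n ω := by
  cases n with
  | zero => exact le_rfl
  | succ n => exact le_max_left _ _

lemma birkhoffMax_le_succ (f : Ω → ℝ) (n : ℕ) (ω : Ω) :
    birkhoffMax T f n ω ≤ birkhoffMax T f (n + 1) ω := by
  induction n generalizing ω with
  | zero => exact birkhoffMax_nonneg f 1 ω
  | succ n ih => exact max_le_max le_rfl (by gcongr; exact ih _)

lemma birkhoffSum_le_birkhoffMax (f : Ω → ℝ) (n : ℕ) (ω : Ω) :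
    birkhoffSum T f n ω ≤ birkhoffMax T f n ω := by
  induction n generalizing ω with
  | zero => simp [birkhoffMax]
  | succ n ih =>
    rw [birkhoffSum_succ']
    exact le_max_of_le_right (by gcongr; exact ih _)

variable [MeasurableSpace Ω] {μ : Measure Ω}

lemma integrable_birkhoffMax (hT : MeasurePreserving T μ μ) {f : Ω → ℝ} (hf : Integrable f μ)
    (n : ℕ) : Integrable (birkhoffMax T f n) μ := by
  induction n with
  | zero => exact integrable_zero _ _ _
  | succ n ih =>
    have := hf.add ((hT.integrable_comp ih.aestronglyMeasurable).2 ih)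
    exact (integrable_zero _ _ _).sup this

/-- If the Birkhoff sums are almost everywhere unbounded above, the integral is nonnegative. -/
lemma integral_nonneg_of_ae_not_bddAbove_birkhoffSum (hT : MeasurePreserving T μ μ) {f : Ω → ℝ}
    (hf : Integrable f μ)
    (h : ∀ᵐ ω ∂μ, ¬ BddAbove (range fun n => birkhoffSum T f n ω)) : 0 ≤ ∫ ω, f ω ∂μ := by
  set M := birkhoffMax T f with hM
  have hMi := integrable_birkhoffMax hT hf
  have hMT : ∀ n, Integrable (fun ω => M n (T ω)) μ := fun n =>
    (hT.integrable_comp (hMi n).aestronglyMeasurable).2 (hMi n)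
  have key : ∀ n, 0 ≤ ∫ ω, max (-(M n (T ω))) (f ω) ∂μ := by
    intro n
    have e : ∀ ω, max (-(M n (T ω))) (f ω) = M (n + 1) ω - M n (T ω) := by
      intro ω
      change _ = max 0 (f ω + M n (T ω)) - M n (T ω)
      rw [← max_sub_sub_right]
      simp
    simp_rw [e]
    rw [integral_sub (hMi _) (hMT n)]
    have : ∫ ω, M n (T ω) ∂μ = ∫ ω, M n ω ∂μ := by
      have hh := hT.map_eq
      conv_rhs => rw [← hh]
      rw [integral_map hT.measurable.aemeasurable]
      rw [hh]; exact (hMi n).aestronglyMeasurable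
    rw [this, sub_nonneg]
    exact integral_mono (hMi n) (hMi _) (fun ω => birkhoffMax_le_succ f n ω)
  have lim : Tendsto (fun n => ∫ ω, max (-(M n (T ω))) (f ω) ∂μ) atTop (𝓝 (∫ ω, f ω ∂μ)) := by
    refine tendsto_integral_of_dominated_convergence (fun ω => |f ω|) ?_ hf.abs ?_ ?_
    · intro n
      exact ((hMT n).neg.sup hf).aestronglyMeasurable
    · intro n
      refine Eventually.of_forall fun ω => ?_
      have h0 := birkhoffMax_nonneg (T := T) f n (T ω)
      rw [Real.norm_eq_abs, abs_le]
      constructor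
      · exact (neg_abs_le _).trans (le_max_right _ _)
      · exact max_le (by change -(birkhoffMax T f n (T ω)) ≤ _; linarith [abs_nonneg (f ω)])
          (le_abs_self _)
    · have h' : ∀ᵐ ω ∂μ, ¬ BddAbove (range fun n => birkhoffSum T f n (T ω)) :=
        hT.quasiMeasurePreserving.ae h
      filter_upwards [h'] with ω hω
      refine tendsto_const_nhds.congr' ?_
      rw [not_bddAbove_iff] at hω
      obtain ⟨_, ⟨n, rfl⟩, hn⟩ := hω (-(f ω))
      filter_upwards [eventually_ge_atTop n] with m hm
      have h1 : M n (T ω) ≤ M m (T ω) :=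
        monotone_nat_of_le_succ (f := fun k => M k (T ω))
          (fun k => birkhoffMax_le_succ f k (T ω)) hm
      have h2 := birkhoffSum_le_birkhoffMax (T := T) f n (T ω)
      rw [max_eq_right]
      change birkhoffMax T f n (T ω) ≤ _ at h1
      linarith
  exact ge_of_tendsto' lim key

variable [IsProbabilityMeasure μ]

lemma Ergodic.ae_eventually_birkhoffSum_le (hT : Ergodic T μ) {f : Ω → ℝ} (hfm : Measurable f)
    (hf : Integrable f μ) {c : ℝ} (hc : ∫ ω, f ω ∂μ < c) :
    ∀ᵐ ω ∂μ, ∀ᶠ n : ℕ in atTop, birkhoffSum T f n ω ≤ n * c := by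
  obtain ⟨b, hb1, hb2⟩ := exists_between hc
  set F : Ω → ℝ := fun ω => f ω - b with hF
  have hFi : Integrable F μ := hf.sub (integrable_const b)
  have hFm : Measurable F := hfm.sub_const b
  set E : Set Ω := {ω | ¬ BddAbove (range fun n => birkhoffSum T F n ω)} with hE
  have hsm : ∀ n, Measurable (birkhoffSum T F n) := fun n =>
    Finset.measurable_sum _ fun k _ => hFm.comp (hT.measurable.iterate k)
  have hEm : MeasurableSet E := by
    have : E = ⋂ K : ℕ, ⋃ n, {ω | (K : ℝ) < birkhoffSum T F n ω} := by
      ext ω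
      simp only [hE, mem_ofPred_eq, not_bddAbove_iff, mem_iInter, mem_iUnion]
      constructor
      · intro h K
        obtain ⟨_, ⟨n, rfl⟩, hn⟩ := h K
        exact ⟨n, hn⟩
      · intro h x
        obtain ⟨K, hK⟩ := exists_nat_gt x
        obtain ⟨n, hn⟩ := h K
        exact ⟨_, ⟨n, rfl⟩, hK.trans hn⟩
    rw [this]
    exact MeasurableSet.iInter fun K => MeasurableSet.iUnion fun n =>
      measurableSet_lt measurable_const (hsm n)
  have hEinv : T ⁻¹' E = E := by
    ext ω
    simp only [hE, mem_preimage, mem_ofPred_eq, not_iff_not]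
    constructor
    · rintro ⟨C, hC⟩
      refine ⟨max 0 (F ω + C), ?_⟩
      rintro _ ⟨n, rfl⟩
      cases n with
      | zero => simp
      | succ n =>
        simp only [birkhoffSum_succ']
        exact le_max_of_le_right (by gcongr; exact hC ⟨n, rfl⟩)
    · rintro ⟨C, hC⟩
      refine ⟨C - F ω, ?_⟩
      rintro _ ⟨n, rfl⟩
      have := hC ⟨n + 1, rfl⟩
      simp only [birkhoffSum_succ'] at this
      linarith
  have hE0 : μ E = 0 := by
    rcases hT.toPreErgodic.prob_eq_zero_or_one hEm hEinv with h | h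
    · exact h
    · exfalso
      have h1 : ∀ᵐ ω ∂μ, ω ∈ E := (prob_compl_eq_zero_iff hEm).2 h
      have h2 := integral_nonneg_of_ae_not_bddAbove_birkhoffSum hT.toMeasurePreserving hFi h1
      rw [integral_sub hf (integrable_const b)] at h2
      simp at h2
      linarith
  have hE1 : ∀ᵐ ω ∂μ, ω ∉ E := measure_eq_zero_iff_ae_notMem.1 hE0
  filter_upwards [hE1] with ω hω
  obtain ⟨C, hC⟩ := not_not.1 hω
  have hlin : ∀ᶠ n : ℕ in atTop, C / (c - b) ≤ n :=
    tendsto_natCast_atTop_atTop.eventually_ge_atTop _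
  filter_upwards [hlin] with n hn
  have h1 : birkhoffSum T F n ω ≤ C := hC ⟨n, rfl⟩
  have h2 : birkhoffSum T F n ω = birkhoffSum T f n ω - n * b := by
    simp [birkhoffSum, hF, Finset.sum_sub_distrib]
  rw [div_le_iff₀ (by linarith)] at hn
  nlinarith

/-- Birkhoff's pointwise ergodic theorem for an ergodic probability-preserving map. -/
theorem Ergodic.ae_tendsto_birkhoffSum_div (hT : Ergodic T μ) {f : Ω → ℝ} (hfm : Measurable f)
    (hf : Integrable f μ) :
    ∀ᵐ ω ∂μ, Tendsto (fun n : ℕ => birkhoffSum T f n ω / n) atTop (𝓝 (∫ ω, f ω ∂μ)) := by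
  have up : ∀ᵐ ω ∂μ, ∀ k : ℕ, ∀ᶠ n : ℕ in atTop,
      birkhoffSum T f n ω ≤ n * (∫ ω, f ω ∂μ + 1 / (k + 1 : ℝ)) := by
    rw [ae_all_iff]
    intro k
    exact hT.ae_eventually_birkhoffSum_le hfm hf
      (by linarith [Nat.one_div_pos_of_nat (α := ℝ) (n := k)])
  have lo : ∀ᵐ ω ∂μ, ∀ k : ℕ, ∀ᶠ n : ℕ in atTop,
      birkhoffSum T (-f) n ω ≤ n * (-∫ ω, f ω ∂μ + 1 / (k + 1 : ℝ)) := by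
    rw [ae_all_iff]
    intro k
    refine hT.ae_eventually_birkhoffSum_le hfm.neg hf.neg ?_
    simp only [Pi.neg_apply, integral_neg]
    linarith [Nat.one_div_pos_of_nat (α := ℝ) (n := k)]
  filter_upwards [up, lo] with ω h1 h2
  refine tendsto_div_natCast_of_eventually_le h1 fun k => ?_
  filter_upwards [h2 k] with n hn
  simpa [birkhoffSum] using hn

end Birkhoff

section Maker

variable {Ω : Type*} [MeasurableSpace Ω] {μ : Measure Ω} {T : Ω → Ω}

/-- A tail of a bounded convergent sequence has supremum close to the limit. -/
lemma tendsto_ciSup_add {u : ℕ → ℝ} {l C : ℝ} (h : Tendsto u atTop (𝓝 l)) (hC : ∀ n, |u n| ≤ C) :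
    Tendsto (fun N => ⨆ j, u (N + j)) atTop (𝓝 l) := by
  have hb : ∀ N, BddAbove (range fun j => u (N + j)) := fun N =>
    ⟨C, by rintro _ ⟨j, rfl⟩; exact (le_abs_self _).trans (hC _)⟩
  rw [Metric.tendsto_atTop] at h ⊢
  intro ε hε
  obtain ⟨N, hN⟩ := h (ε / 2) (by positivity)
  refine ⟨N, fun n hn => ?_⟩
  have h1 : ⨆ j, u (n + j) ≤ l + ε / 2 := ciSup_le fun j => by
    have := hN (n + j) (by omega)
    rw [Real.dist_eq, abs_lt] at this
    linarith
  have h2 : u n ≤ ⨆ j, u (n + j) := le_ciSup (hb n) 0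
  have h3 := hN n hn
  rw [Real.dist_eq, abs_lt] at h3 ⊢
  constructor <;> linarith

variable [IsProbabilityMeasure μ]

/-- One-sided form of Maker's ergodic theorem. -/
lemma Ergodic.ae_eventually_cocycle_le (hT : Ergodic T μ) {g : ℕ → Ω → ℝ} {g' G : Ω → ℝ}
    (hgm : ∀ n, Measurable (g n)) (hGm : Measurable G) (hG : Integrable G μ)
    (hgG : ∀ᵐ ω ∂μ, ∀ n, |g n ω| ≤ G ω)
    (hlim : ∀ᵐ ω ∂μ, Tendsto (fun n => g n ω) atTop (𝓝 (g' ω)))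
    {φ : ℕ → Ω → ℝ} (hφ0 : ∀ ω, φ 0 ω = 0)
    (hφ : ∀ n ω, φ (n + 1) ω = g n ω + φ n (T ω)) {c : ℝ} (hc : ∫ ω, g' ω ∂μ < c) :
    ∀ᵐ ω ∂μ, ∀ᶠ n : ℕ in atTop, φ n ω ≤ n * c := by
  set H : ℕ → Ω → ℝ := fun N ω => ⨆ j, g (N + j) ω with hH
  have hHm : ∀ N, Measurable (H N) := fun N => Measurable.iSup fun j => hgm (N + j)
  have hbdd : ∀ᵐ ω ∂μ, ∀ N, BddAbove (range fun j => g (N + j) ω) := by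
    filter_upwards [hgG] with ω hω N
    exact ⟨G ω, by rintro _ ⟨j, rfl⟩; exact (le_abs_self _).trans (hω _)⟩
  have hHG : ∀ N, ∀ᵐ ω ∂μ, ‖H N ω‖ ≤ G ω := by
    intro N
    filter_upwards [hgG, hbdd] with ω h1 h2
    rw [Real.norm_eq_abs, abs_le]
    constructor
    · exact (abs_le.1 (h1 (N + 0))).1.trans (le_ciSup (h2 N) 0)
    · exact ciSup_le fun j => (abs_le.1 (h1 (N + j))).2
  have hHi : ∀ N, Integrable (H N) μ := fun N =>
    hG.mono' (hHm N).aestronglyMeasurable (hHG N)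
  have hint : Tendsto (fun N => ∫ ω, H N ω ∂μ) atTop (𝓝 (∫ ω, g' ω ∂μ)) := by
    refine tendsto_integral_of_dominated_convergence G
      (fun N => (hHm N).aestronglyMeasurable) hG hHG ?_
    filter_upwards [hlim, hgG] with ω h1 h2
    exact tendsto_ciSup_add h1 h2
  obtain ⟨N, hN⟩ := ((tendsto_order.1 hint).2 c hc).exists
  have hgGT : ∀ᵐ ω ∂μ, ∀ k n, |g n (T^[k] ω)| ≤ G (T^[k] ω) :=
    ae_all_iff.2 fun k => (hT.toMeasurePreserving.iterate k).quasiMeasurePreserving.ae hgG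
  have hbddT : ∀ᵐ ω ∂μ, ∀ k N, BddAbove (range fun j => g (N + j) (T^[k] ω)) :=
    ae_all_iff.2 fun k => (hT.toMeasurePreserving.iterate k).quasiMeasurePreserving.ae hbdd
  obtain ⟨b, hb1, hb2⟩ := exists_between hN
  filter_upwards [hgGT, hbddT, hT.ae_eventually_birkhoffSum_le (hHm N) (hHi N) hb1,
    hT.ae_tendsto_birkhoffSum_div hGm hG] with ω h1 h2 h3 h4
  have main : ∀ m k, φ (m + N) (T^[k] ω)
      ≤ birkhoffSum T (H N) m (T^[k] ω) + φ N (T^[k + m] ω) := by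
    intro m
    induction m with
    | zero => intro k; simp
    | succ m ih =>
      intro k
      have e1 := ih (k + 1)
      rw [Function.iterate_succ_apply'] at e1
      rw [show m + 1 + N = (m + N) + 1 by ring, hφ, birkhoffSum_succ',
        show k + (m + 1) = k + 1 + m by ring]
      have e2 : g (m + N) (T^[k] ω) ≤ H N (T^[k] ω) := by
        rw [add_comm m N]
        exact le_ciSup (h2 k N) m
      linarith
  have tail : ∀ n k, φ n (T^[k] ω) ≤ birkhoffSum T G n (T^[k] ω) := by
    intro n
    induction n with
    | zero => intro k; simp [hφ0]
    | succ n ih =>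
      intro k
      have e1 := ih (k + 1)
      rw [Function.iterate_succ_apply'] at e1
      rw [hφ, birkhoffSum_succ']
      have e2 := (abs_le.1 (h1 k n)).2
      linarith
  have hrem : Tendsto (fun m : ℕ => birkhoffSum T G N (T^[m] ω) / m) atTop (𝓝 0) := by
    have a1 : Tendsto (fun m : ℕ => birkhoffSum T G (m + N) ω / ((m + N : ℕ) : ℝ)) atTop
        (𝓝 (∫ ω, G ω ∂μ)) := h4.comp (tendsto_add_atTop_nat N)
    have a2 : Tendsto (fun m : ℕ => (((m + N : ℕ) : ℝ) / m)) atTop (𝓝 1) := by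
      have : Tendsto (fun m : ℕ => 1 + (N : ℝ) / m) atTop (𝓝 (1 + 0)) :=
        tendsto_const_nhds.add (tendsto_const_div_atTop_nhds_zero_nat _)
      rw [add_zero] at this
      refine this.congr' ?_
      filter_upwards [eventually_gt_atTop 0] with m hm
      have : (m : ℝ) ≠ 0 := by positivity
      push_cast
      field_simp
    have a3 := (a1.mul a2).sub h4
    rw [mul_one, sub_self] at a3
    refine a3.congr' ?_
    filter_upwards [eventually_gt_atTop 0] with m hm
    have : (m : ℝ) ≠ 0 := by positivity
    have h' : ((m + N : ℕ) : ℝ) ≠ 0 := by positivity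
    rw [birkhoffSum_add]
    field_simp
    ring
  have h5 : ∀ᶠ m : ℕ in atTop, birkhoffSum T G N (T^[m] ω) / m < (c - b) / 2 :=
    (tendsto_order.1 hrem).2 _ (by linarith)
  have h6 : ∀ᶠ m : ℕ in atTop, N * |c| ≤ m * ((c - b) / 2) := by
    have : Tendsto (fun m : ℕ => (m : ℝ) * ((c - b) / 2)) atTop atTop :=
      tendsto_natCast_atTop_atTop.atTop_mul_const (by linarith)
    exact this.eventually_ge_atTop _
  rw [← map_add_atTop_eq_nat N, eventually_map]
  filter_upwards [h3, h5, h6, eventually_gt_atTop 0] with m a1 a2 a3 hm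
  have hm' : (0 : ℝ) < m := by exact_mod_cast hm
  have b1 := main m 0
  have b2 := tail N m
  simp only [zero_add, Function.iterate_zero, id_eq] at b1
  rw [div_lt_iff₀ hm'] at a2
  have b3 : -(N * |c|) ≤ N * c := by
    have := mul_le_mul_of_nonneg_left (neg_abs_le c) (Nat.cast_nonneg (α := ℝ) N)
    linarith
  push_cast
  linarith

/-- Maker's ergodic theorem, for a cocycle-like sequence `φ`. -/
theorem Ergodic.ae_tendsto_cocycle_div (hT : Ergodic T μ) {g : ℕ → Ω → ℝ} {g' G : Ω → ℝ}
    (hgm : ∀ n, Measurable (g n)) (hGm : Measurable G) (hG : Integrable G μ)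
    (hgG : ∀ᵐ ω ∂μ, ∀ n, |g n ω| ≤ G ω)
    (hlim : ∀ᵐ ω ∂μ, Tendsto (fun n => g n ω) atTop (𝓝 (g' ω)))
    {φ : ℕ → Ω → ℝ} (hφ0 : ∀ ω, φ 0 ω = 0)
    (hφ : ∀ n ω, φ (n + 1) ω = g n ω + φ n (T ω)) :
    ∀ᵐ ω ∂μ, Tendsto (fun n : ℕ => φ n ω / n) atTop (𝓝 (∫ ω, g' ω ∂μ)) := by
  have up : ∀ᵐ ω ∂μ, ∀ k : ℕ, ∀ᶠ n : ℕ in atTop,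
      φ n ω ≤ n * (∫ ω, g' ω ∂μ + 1 / (k + 1 : ℝ)) := by
    rw [ae_all_iff]
    intro k
    exact hT.ae_eventually_cocycle_le hgm hGm hG hgG hlim hφ0 hφ
      (by linarith [Nat.one_div_pos_of_nat (α := ℝ) (n := k)])
  have lo : ∀ᵐ ω ∂μ, ∀ k : ℕ, ∀ᶠ n : ℕ in atTop,
      -φ n ω ≤ n * (-∫ ω, g' ω ∂μ + 1 / (k + 1 : ℝ)) := by
    rw [ae_all_iff]
    intro k
    refine hT.ae_eventually_cocycle_le (g := fun n ω => -g n ω) (g' := fun ω => -g' ω)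
      (φ := fun n ω => -φ n ω) (fun n => (hgm n).neg) hGm hG
      (by simpa only [abs_neg] using hgG) ?_ (by simp [hφ0]) (fun n ω => by rw [hφ]; ring) ?_
    · filter_upwards [hlim] with ω hω using hω.neg
    · rw [integral_neg]
      linarith [Nat.one_div_pos_of_nat (α := ℝ) (n := k)]
  filter_upwards [up, lo] with ω h1 h2
  exact tendsto_div_natCast_of_eventually_le h1 h2

end Maker

section Bernoulli

open ProbabilityTheory

variable {α : Type*}

/-- The one-sided shift on sequences. -/
def seqShift (ω : ℕ → α) : ℕ → α := fun n => ω (n + 1)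

lemma seqShift_iterate (n k : ℕ) (ω : ℕ → α) : (seqShift^[n] ω) k = ω (k + n) := by
  induction n generalizing ω with
  | zero => rfl
  | succ n ih => rw [Function.iterate_succ_apply, ih]; rfl

variable [MeasurableSpace α]

lemma measurable_seqShift : Measurable (seqShift (α := α)) :=
  measurable_pi_lambda _ fun n => measurable_pi_apply (n + 1)

variable (p : Measure α) [IsProbabilityMeasure p]

lemma measurePreserving_seqShift :
    MeasurePreserving seqShift (Measure.infinitePi fun _ : ℕ => p)
      (Measure.infinitePi fun _ : ℕ => p) := by
  refine ⟨measurable_seqShift, ?_⟩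
  exact Measure.map_infinitePi_infinitePi_of_inj (P := fun _ : ℕ => p) (f := Nat.succ)
    Nat.succ_injective

lemma infinitePi_inter_seqShift_preimage {S : Set α} (hS : MeasurableSet S) {B : Set (ℕ → α)}
    (hB : MeasurableSet B) :
    (Measure.infinitePi fun _ : ℕ => p) ((fun ω => ω 0) ⁻¹' S ∩ seqShift ⁻¹' B)
      = p S * (Measure.infinitePi fun _ : ℕ => p) B := by
  set μ := Measure.infinitePi fun _ : ℕ => p with hμ
  have h0 : Measurable fun ω : ℕ → α => ω 0 := measurable_pi_apply 0
  have hμS : μ ((fun ω => ω 0) ⁻¹' S) = p S := by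
    rw [← Measure.map_apply h0 hS, hμ]
    congr 1
    exact Measure.infinitePi_map_eval (fun _ : ℕ => p) 0
  by_cases hp : p S = 0
  · rw [hp, zero_mul]
    exact measure_mono_null inter_subset_left (hμS.trans hp)
  have key : (p S)⁻¹ • (μ.restrict ((fun ω => ω 0) ⁻¹' S)).map seqShift = μ := by
    refine Measure.eq_infinitePi _ fun s t ht => ?_
    have hm : MeasurableSet (Set.pi (s : Set ℕ) t) :=
      MeasurableSet.pi s.countable_toSet fun i _ => ht i
    rw [Measure.smul_apply, Measure.map_apply measurable_seqShift hm,
      Measure.restrict_apply (measurable_seqShift hm), smul_eq_mul]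
    have e : seqShift ⁻¹' (Set.pi (s : Set ℕ) t) ∩ (fun ω : ℕ → α => ω 0) ⁻¹' S
        = Set.pi ((insert 0 (s.map ⟨Nat.succ, Nat.succ_injective⟩) : Finset ℕ) : Set ℕ)
          (fun n => Nat.casesOn n S t) := by
      ext ω
      simp [seqShift, and_comm]
    rw [e, hμ, Measure.infinitePi_pi, Finset.prod_insert (by simp), Finset.prod_map]
    · simp only [Function.Embedding.coeFn_mk]
      change (p S)⁻¹ * (p S * _) = _
      rw [← mul_assoc, ENNReal.inv_mul_cancel hp (measure_ne_top _ _), one_mul]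
    · rintro (_ | n) -
      · exact hS
      · exact ht n
  have := congrArg (fun m : Measure (ℕ → α) => p S * m B) key
  simp only [Measure.smul_apply, smul_eq_mul] at this
  rw [← mul_assoc, ENNReal.mul_inv_cancel hp (measure_ne_top _ _), one_mul,
    Measure.map_apply measurable_seqShift hB,
      Measure.restrict_apply (measurable_seqShift hB)] at this
  rw [inter_comm, this]

/-- The Bernoulli shift is ergodic. -/
theorem ergodic_seqShift :
    Ergodic seqShift (Measure.infinitePi fun _ : ℕ => p) := by
  refine ⟨measurePreserving_seqShift p, ⟨fun A hA hinv => ?_⟩⟩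
  have hind : iIndep (fun n : ℕ => MeasurableSpace.comap (fun ω : ℕ → α => ω n) inferInstance)
      (Measure.infinitePi fun _ : ℕ => p) :=
    iIndepFun_infinitePi (P := fun _ : ℕ => p) (X := fun _ x => x) (fun _ => measurable_id)
  have htail : MeasurableSet[limsup
      (fun n : ℕ => MeasurableSpace.comap (fun ω : ℕ → α => ω n) inferInstance) atTop] A := by
    rw [limsup_eq_iInf_iSup_of_nat, MeasurableSpace.measurableSet_iInf]
    intro n
    have hA' : seqShift^[n] ⁻¹' A = A := by
      induction n with
      | zero => rfl
      | succ n ih => rw [Function.iterate_succ, preimage_comp, ih, hinv]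
    have hsm : Measurable[⨆ i ≥ n, MeasurableSpace.comap (fun ω : ℕ → α => ω i) inferInstance]
        (seqShift (α := α))^[n] := by
      refine @measurable_pi_lambda _ _ _ (_) _ _ fun k => ?_
      simp only [seqShift_iterate]
      refine Measurable.mono (comap_measurable _) (le_iSup₂_of_le (k + n) (by omega) le_rfl) le_rfl
    rw [← hA']
    exact hsm hA
  rw [Filter.eventuallyConst_set']
  rcases measure_zero_or_one_of_measurableSet_limsup_atTop
    (fun n => (measurable_pi_apply n).comap_le) hind htail with h | h
  · left
    rwa [ae_eq_empty]
  · right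
    rw [ae_eq_univ]
    exact (prob_compl_eq_zero_iff hA).2 h

end Bernoulli

section SelfSimilar

/-- `η` is a self-similar measure for the maps `x ↦ x / 2 + t i`, with equal weights. -/
def IsHalvingMeasure (t : Fin 3 → ℝ) (η : Measure ℝ) : Prop :=
  η = (3 : ℝ≥0∞)⁻¹ • ∑ i, η.map fun x => x / 2 + t i

lemma measurable_halving (c : ℝ) : Measurable fun x : ℝ => x / 2 + c := by fun_prop

/-- The uniform measure on three symbols. -/
def unifThree : Measure (Fin 3) := (3 : ℝ≥0∞)⁻¹ • Measure.count

lemma unifThree_singleton (i : Fin 3) : unifThree {i} = 3⁻¹ := by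
  simp [unifThree]

instance : IsProbabilityMeasure unifThree := by
  refine ⟨?_⟩
  rw [unifThree, Measure.smul_apply, Measure.count_univ]
  simp [ENNReal.inv_mul_cancel]

/-- The Bernoulli measure with equal weights on sequences of three symbols. -/
abbrev bernThree : Measure (ℕ → Fin 3) := Measure.infinitePi fun _ : ℕ => unifThree

/-- The point with address `ω` for the maps `x ↦ x / 2 + t i`. -/
def codePoint (t : Fin 3 → ℝ) (ω : ℕ → Fin 3) : ℝ := ∑' k, t (ω k) / 2 ^ k

variable {t : Fin 3 → ℝ}

lemma summable_code (ω : ℕ → Fin 3) : Summable fun k => t (ω k) / 2 ^ k := by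
  refine Summable.of_norm_bounded (g := fun k => (∑ i, |t i|) * (1 / 2) ^ k)
    (summable_geometric_two.mul_left _) fun k => ?_
  rw [Real.norm_eq_abs, abs_div, abs_of_pos (by positivity : (0 : ℝ) < 2 ^ k), one_div, inv_pow,
    div_eq_mul_inv]
  gcongr
  exact Finset.single_le_sum (f := fun i => |t i|) (fun i _ => abs_nonneg _) (Finset.mem_univ (ω k))

lemma codePoint_eq (ω : ℕ → Fin 3) :
    codePoint t ω = codePoint t (seqShift ω) / 2 + t (ω 0) := by
  rw [codePoint, (summable_code ω).tsum_eq_zero_add, codePoint, ← tsum_div_const]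
  simp only [seqShift, pow_succ, pow_zero, div_one, div_div]
  ring

lemma measurable_codePoint : Measurable (codePoint t) := by
  have h : ∀ n, Measurable fun ω : ℕ → Fin 3 => ∑ k ∈ Finset.range n, t (ω k) / 2 ^ k := by
    intro n
    refine Finset.measurable_fun_sum _ fun k _ => ?_
    exact ((measurable_of_finite t).comp (measurable_pi_apply k)).div_const _
  refine measurable_of_tendsto_metrizable h (tendsto_pi_nhds.2 fun ω => ?_)
  exact (summable_code ω).hasSum.tendsto_sum_nat

lemma codePoint_mem_Icc {M : ℝ} (h0 : ∀ i, 0 ≤ t i) (hM : ∀ i, t i ≤ M / 2) (ω : ℕ → Fin 3) :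
    codePoint t ω ∈ Icc 0 M := by
  refine ⟨tsum_nonneg fun k => div_nonneg (h0 _) (by positivity), ?_⟩
  have h : ∑' k : ℕ, M / 2 * (1 / 2 : ℝ) ^ k = M := by
    rw [tsum_mul_left, tsum_geometric_two]; ring
  rw [← h]
  refine (summable_code ω).tsum_le_tsum (fun k => ?_) (summable_geometric_two.mul_left _)
  rw [one_div, inv_pow, div_eq_mul_inv]
  gcongr
  exact hM _

lemma isHalvingMeasure_map_codePoint : IsHalvingMeasure t (bernThree.map (codePoint t)) := by
  refine Measure.ext fun A hA => ?_
  rw [Measure.map_apply measurable_codePoint hA, Measure.smul_apply, Measure.finsetSum_apply,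
    smul_eq_mul, Finset.mul_sum]
  have h0 : Measurable fun ω : ℕ → Fin 3 => ω 0 := measurable_pi_apply 0
  have hm : ∀ i, MeasurableSet ((fun ω => codePoint t ω / 2 + t i) ⁻¹' A) := fun i =>
    ((measurable_halving (t i)).comp measurable_codePoint) hA
  have hd : codePoint t ⁻¹' A = ⋃ i, ((fun ω : ℕ → Fin 3 => ω 0) ⁻¹' {i} ∩
      seqShift ⁻¹' ((fun ω => codePoint t ω / 2 + t i) ⁻¹' A)) := by
    ext ω
    simp [codePoint_eq ω]
  rw [hd, measure_iUnion, tsum_fintype]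
  · refine Finset.sum_congr rfl fun i _ => ?_
    rw [infinitePi_inter_seqShift_preimage unifThree (measurableSet_singleton i) (hm i),
      unifThree_singleton, Measure.map_apply (measurable_halving _) hA,
      Measure.map_apply measurable_codePoint (measurable_halving _ hA)]
    rfl
  · intro i j hij
    refine Set.disjoint_left.2 fun ω h1 h2 => hij ?_
    exact h1.1.symm.trans h2.1
  · exact fun i => (h0 (measurableSet_singleton i)).inter (measurable_seqShift (hm i))

lemma charFun_map_halving (η : Measure ℝ) [IsProbabilityMeasure η] (c ξ : ℝ) :
    charFun (η.map fun x => x / 2 + c) ξ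
      = charFun η (ξ / 2) * Complex.exp ((c * ξ : ℝ) * Complex.I) := by
  have h : (fun x : ℝ => x / 2 + c) = (fun x => x + c) ∘ (fun x => 2⁻¹ * x) := by
    ext x; simp; ring
  rw [h, ← Measure.map_map (by fun_prop) (by fun_prop), charFun_map_add_const, charFun_map_mul]
  congr 2
  · ring
  · simp [mul_comm]

lemma IsHalvingMeasure.charFun_eq {η : Measure ℝ} [IsProbabilityMeasure η]
    (hη : IsHalvingMeasure t η) (ξ : ℝ) :
    charFun η ξ
      = charFun η (ξ / 2) * (3⁻¹ * ∑ i, Complex.exp ((t i * ξ : ℝ) * Complex.I)) := by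
  have hi : ∀ c : ℝ, IsProbabilityMeasure (η.map fun x => x / 2 + c) := fun c =>
    Measure.isProbabilityMeasure_map (measurable_halving c).aemeasurable
  conv_lhs => rw [hη, charFun_apply, integral_smul_measure, integral_finsetSum_measure (by
    intro i _
    have := hi (t i)
    refine Integrable.of_bound (C := 1) (by fun_prop) (ae_of_all _ fun x => ?_)
    rw [Complex.norm_exp_ofReal_mul_I])]
  simp only [← charFun_apply, charFun_map_halving]
  rw [← Finset.mul_sum]
  simp only [ENNReal.toReal_inv, ENNReal.toReal_ofNat, Complex.real_smul]
  push_cast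
  ring

lemma IsHalvingMeasure.ext {η η' : Measure ℝ} [IsProbabilityMeasure η] [IsProbabilityMeasure η']
    (hη : IsHalvingMeasure t η) (hη' : IsHalvingMeasure t η') : η = η' := by
  refine Measure.ext_of_charFun (funext fun ξ => ?_)
  have hstep : ∀ ξ, ‖charFun η ξ - charFun η' ξ‖ ≤ ‖charFun η (ξ / 2) - charFun η' (ξ / 2)‖ := by
    intro ξ
    rw [hη.charFun_eq, hη'.charFun_eq, ← sub_mul, norm_mul]
    refine mul_le_of_le_one_right (norm_nonneg _) ?_
    rw [norm_mul]
    have : ‖∑ i, Complex.exp ((t i * ξ : ℝ) * Complex.I)‖ ≤ 3 := by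
      refine (norm_sum_le _ _).trans ?_
      simp only [Complex.norm_exp_ofReal_mul_I]
      simp
    rw [norm_inv, Complex.norm_ofNat]
    linarith
  have hpow : ∀ n : ℕ, ‖charFun η ξ - charFun η' ξ‖
      ≤ ‖charFun η (ξ * (1 / 2) ^ n) - charFun η' (ξ * (1 / 2) ^ n)‖ := by
    intro n
    induction n with
    | zero => simp
    | succ n ih =>
      refine ih.trans ((hstep _).trans_eq ?_)
      rw [pow_succ]; congr 3 <;> ring
  have hlim : Tendsto (fun n : ℕ => ‖charFun η (ξ * (1 / 2) ^ n) - charFun η' (ξ * (1 / 2) ^ n)‖)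
      atTop (𝓝 0) := by
    have h0 : Tendsto (fun n : ℕ => ξ * (1 / 2 : ℝ) ^ n) atTop (𝓝 0) := by
      simpa using (tendsto_pow_atTop_nhds_zero_of_lt_one (by norm_num : (0 : ℝ) ≤ 1 / 2)
        (by norm_num)).const_mul ξ
    have hc : Continuous fun ξ => ‖charFun η ξ - charFun η' ξ‖ :=
      (continuous_charFun.sub continuous_charFun).norm
    have := (hc.tendsto 0).comp h0
    simpa [Function.comp_def] using this
  have := ge_of_tendsto' hlim hpow
  exact sub_eq_zero.1 (norm_le_zero_iff.1 this)

lemma IsHalvingMeasure.map_codePoint {η : Measure ℝ} [IsProbabilityMeasure η]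
    (hη : IsHalvingMeasure t η) : bernThree.map (codePoint t) = η := by
  have := Measure.isProbabilityMeasure_map (μ := bernThree)
    (measurable_codePoint (t := t)).aemeasurable
  exact isHalvingMeasure_map_codePoint.ext hη

lemma IsHalvingMeasure.ae_mem_Icc {t : Fin 3 → ℝ} {η : Measure ℝ} [IsProbabilityMeasure η]
    (hη : IsHalvingMeasure t η) {M : ℝ} (h0 : ∀ i, 0 ≤ t i) (h1 : ∀ i, t i ≤ M / 2) :
    ∀ᵐ x ∂η, x ∈ Icc 0 M := by
  rw [← hη.map_codePoint]
  exact (ae_map_iff measurable_codePoint.aemeasurable measurableSet_Icc).2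
    (ae_of_all _ (codePoint_mem_Icc h0 h1))

end SelfSimilar

/-- A weak-type maximal inequality, from the Besicovitch covering theorem. -/
theorem exists_measure_le_of_closedBall_le :
    ∃ N : ℕ, ∀ (ρ η : Measure ℝ) [IsFiniteMeasure η] (s : ℝ≥0∞) (R : ℝ) (E : Set ℝ),
      (∀ x ∈ E, ∃ r, 0 < r ∧ r ≤ R ∧ ρ (closedBall x r) ≤ s * η (closedBall x r)) →
      ρ E ≤ N * (s * η univ) := by
  obtain ⟨N, τ, hτ, hN⟩ := HasBesicovitchCovering.no_satelliteConfig (α := ℝ)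
  refine ⟨N, fun ρ η _ s R E hE => ?_⟩
  choose! r hr0 hrR hr using hE
  let q : Besicovitch.BallPackage E ℝ := ⟨fun x => x, fun x => r x, fun x => hr0 x x.2, R,
    fun x => hrR x x.2⟩
  obtain ⟨f, hfd, hfc⟩ := Besicovitch.exist_disjoint_covering_families hτ hN q
  have hcount : ∀ i, (f i).Countable := fun i =>
    (hfd i).countable_of_nonempty_interior fun x _ => by
      exact (nonempty_ball.2 (q.rpos x)).mono ball_subset_interior_closedBall
  have hfam : ∀ i, ρ (⋃ j ∈ f i, ball (q.c j) (q.r j)) ≤ s * η univ := by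
    intro i
    calc ρ (⋃ j ∈ f i, ball (q.c j) (q.r j))
        ≤ ρ (⋃ j ∈ f i, closedBall (q.c j) (q.r j)) :=
          measure_mono (iUnion₂_mono fun j _ => ball_subset_closedBall)
      _ ≤ ∑' j : f i, ρ (closedBall (q.c j) (q.r j)) := measure_biUnion_le _ (hcount i) _
      _ ≤ ∑' j : f i, s * η (closedBall (q.c j) (q.r j)) :=
          ENNReal.tsum_le_tsum fun j => hr j j.1.2
      _ = s * ∑' j : f i, η (closedBall (q.c j) (q.r j)) := ENNReal.tsum_mul_left
      _ = s * η (⋃ j ∈ f i, closedBall (q.c j) (q.r j)) := by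
          rw [measure_biUnion (hcount i) (hfd i) fun j _ => measurableSet_closedBall]
      _ ≤ s * η univ := by gcongr; exact subset_univ _
  calc ρ E ≤ ρ (⋃ i, ⋃ j ∈ f i, ball (q.c j) (q.r j)) :=
        measure_mono fun x hx => hfc ⟨⟨x, hx⟩, rfl⟩
    _ ≤ ∑ i, ρ (⋃ j ∈ f i, ball (q.c j) (q.r j)) :=
        measure_iUnion_fintype_le _ _
    _ ≤ ∑ _i : Fin N, s * η univ := Finset.sum_le_sum fun i _ => hfam i
    _ = N * (s * η univ) := by simp

lemma ENNReal.le_tsum_indicator_lt (a : ℝ≥0∞) :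
    a ≤ ∑' k : ℕ, if (k : ℝ≥0∞) < a then 1 else 0 := by
  induction a using ENNReal.recTopCoe with
  | top => simp
  | coe a =>
    calc (a : ℝ≥0∞) ≤ (⌈a⌉₊ : ℝ≥0∞) := by exact_mod_cast Nat.le_ceil a
      _ = ∑ k ∈ Finset.range ⌈a⌉₊, if (k : ℝ≥0∞) < a then 1 else 0 := by
        rw [Finset.sum_congr rfl (g := fun _ => (1 : ℝ≥0∞))]
        · simp
        · intro k hk
          rw [if_pos]
          exact_mod_cast Nat.lt_ceil.1 (Finset.mem_range.1 hk)
      _ ≤ _ := ENNReal.sum_le_tsum _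

lemma lintegral_le_tsum_measure_lt {Ω : Type*} [MeasurableSpace Ω] {μ : Measure Ω} {H : Ω → ℝ≥0∞}
    (hH : Measurable H) : ∫⁻ ω, H ω ∂μ ≤ ∑' k : ℕ, μ {ω | (k : ℝ≥0∞) < H ω} := by
  have hm : ∀ k : ℕ, MeasurableSet {ω | (k : ℝ≥0∞) < H ω} := fun k =>
    measurableSet_lt measurable_const hH
  calc ∫⁻ ω, H ω ∂μ ≤ ∫⁻ ω, ∑' k : ℕ, ({ω | (k : ℝ≥0∞) < H ω}.indicator 1 ω) ∂μ := by
        refine lintegral_mono fun ω => (ENNReal.le_tsum_indicator_lt _).trans_eq ?_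
        simp [indicator_apply]
    _ = ∑' k : ℕ, μ {ω | (k : ℝ≥0∞) < H ω} := by
        rw [lintegral_tsum fun k => (measurable_one.indicator (hm k)).aemeasurable]
        simp [lintegral_indicator_one (hm _)]

lemma measurable_measure_closedBall (η : Measure ℝ) [SFinite η] (r : ℝ) :
    Measurable fun x => η (closedBall x r) := by
  have : MeasurableSet {p : ℝ × ℝ | dist p.2 p.1 ≤ r} :=
    (isClosed_le (by fun_prop) continuous_const).measurableSet
  exact measurable_measure_prodMk_left this

lemma ae_measure_closedBall_pos (η : Measure ℝ) :
    ∀ᵐ x ∂η, ∀ r, 0 < r → 0 < η (closedBall x r) := by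
  filter_upwards [Measure.support_mem_ae (μ := η)] with x hx r hr
  exact (Measure.mem_support_iff_forall x).1 hx _ (closedBall_mem_nhds x hr)

section ExactDimension

variable {t : Fin 3 → ℝ} {η : Measure ℝ}

/-- The part of a halving measure coming from the first-level cylinder `i`. -/
def halvingPiece (t : Fin 3 → ℝ) (η : Measure ℝ) (i : Fin 3) : Measure ℝ :=
  (3 : ℝ≥0∞)⁻¹ • η.map fun x => x / 2 + t i

instance [IsFiniteMeasure η] (i : Fin 3) : IsFiniteMeasure (halvingPiece t η i) := by
  exact Measure.smul_finite _ (by simp)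

lemma IsHalvingMeasure.eq_sum_halvingPiece (hη : IsHalvingMeasure t η) :
    η = ∑ i, halvingPiece t η i := by
  conv_lhs => rw [hη]
  simp only [halvingPiece, Finset.smul_sum]

lemma IsHalvingMeasure.halvingPiece_le (hη : IsHalvingMeasure t η) (i : Fin 3) :
    halvingPiece t η i ≤ η := by
  conv_rhs => rw [hη.eq_sum_halvingPiece]
  exact Finset.single_le_sum (f := fun i => halvingPiece t η i) (fun _ _ => Measure.zero_le _)
    (Finset.mem_univ i)

lemma halvingPiece_closedBall (i : Fin 3) (y r : ℝ) :
    halvingPiece t η i (closedBall (y / 2 + t i) (r / 2)) = 3⁻¹ * η (closedBall y r) := by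
  rw [halvingPiece, Measure.smul_apply, Measure.map_apply (measurable_halving _)
    measurableSet_closedBall, smul_eq_mul]
  congr 2
  ext z
  simp only [mem_preimage, mem_closedBall, Real.dist_eq]
  rw [show z / 2 + t i - (y / 2 + t i) = (z - y) / 2 by ring, abs_div, abs_two]
  constructor <;> intro h <;> linarith

lemma IsHalvingMeasure.ae_codePoint [IsProbabilityMeasure η] (hη : IsHalvingMeasure t η)
    {P : Fin 3 → ℝ → Prop} (hP : ∀ i, ∀ᵐ x ∂(halvingPiece t η i), P i x) :
    ∀ᵐ ω ∂bernThree, P (ω 0) (codePoint t ω) := by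
  have h1 : ∀ i, ∀ᵐ ω ∂bernThree, P i (codePoint t (seqShift ω) / 2 + t i) := by
    intro i
    have h2 : ∀ᵐ x ∂(η.map fun x => x / 2 + t i), P i x := by
      have := hP i
      rwa [halvingPiece, Measure.ae_ennreal_smul_measure_iff (by simp)] at this
    have h3 := ae_of_ae_map (measurable_halving _).aemeasurable h2
    rw [← hη.map_codePoint] at h3
    have h4 := ae_of_ae_map measurable_codePoint.aemeasurable h3
    exact (measurePreserving_seqShift unifThree).quasiMeasurePreserving.ae h4
  filter_upwards [ae_all_iff.2 h1] with ω hω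
  rw [codePoint_eq]
  exact hω _

lemma IsHalvingMeasure.measure_codePoint_le [IsProbabilityMeasure η] (hη : IsHalvingMeasure t η)
    {E : Fin 3 → Set ℝ} (hE : ∀ i, MeasurableSet (E i)) :
    bernThree {ω | codePoint t ω ∈ E (ω 0)} ≤ ∑ i, 3 * halvingPiece t η i (E i) := by
  calc bernThree {ω | codePoint t ω ∈ E (ω 0)}
      ≤ bernThree (⋃ i, {ω | codePoint t (seqShift ω) / 2 + t i ∈ E i}) := by
        refine measure_mono fun ω hω => mem_iUnion.2 ⟨ω 0, ?_⟩
        rw [mem_ofPred_eq] at hω ⊢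
        rwa [codePoint_eq] at hω
    _ ≤ ∑ i, bernThree {ω | codePoint t (seqShift ω) / 2 + t i ∈ E i} :=
        measure_iUnion_fintype_le _ _
    _ = ∑ i, 3 * halvingPiece t η i (E i) := by
        refine Finset.sum_congr rfl fun i _ => ?_
        have hm := measurable_halving (t i) (hE i)
        rw [halvingPiece, Measure.smul_apply, smul_eq_mul, ← mul_assoc,
          ENNReal.mul_inv_cancel (by simp) (by simp), one_mul,
          Measure.map_apply (measurable_halving _) (hE i)]
        conv_rhs => rw [← hη.map_codePoint, Measure.map_apply measurable_codePoint hm,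
          ← (measurePreserving_seqShift unifThree).measure_preimage
            (measurable_codePoint hm).nullMeasurableSet]
        rfl

/-- `-log` of the mass of the ball of radius `M / 2 ^ n` around the coded point. -/
def codeInfo (t : Fin 3 → ℝ) (η : Measure ℝ) (M : ℝ) (n : ℕ) (ω : ℕ → Fin 3) : ℝ :=
  -Real.log (η.real (closedBall (codePoint t ω) (M / 2 ^ n)))

lemma measurable_codeInfo [IsFiniteMeasure η] (M : ℝ) (n : ℕ) : Measurable (codeInfo t η M n) :=
  (Real.measurable_log.comp
    ((measurable_measure_closedBall η _).ennreal_toReal.comp measurable_codePoint)).neg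

/-- The increment of `codeInfo` along the shift. -/
def codeInc (t : Fin 3 → ℝ) (η : Measure ℝ) (M : ℝ) (n : ℕ) (ω : ℕ → Fin 3) : ℝ :=
  codeInfo t η M (n + 1) ω - codeInfo t η M n (seqShift ω)

lemma measurable_codeInc [IsFiniteMeasure η] (M : ℝ) (n : ℕ) : Measurable (codeInc t η M n) :=
  (measurable_codeInfo M _).sub ((measurable_codeInfo M _).comp measurable_seqShift)

lemma IsHalvingMeasure.ae_codeInc_eq [IsProbabilityMeasure η] (hη : IsHalvingMeasure t η) {M : ℝ}
    (hM : 0 < M) :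
    ∀ᵐ ω ∂bernThree, ∀ n,
      0 < halvingPiece t η (ω 0) (closedBall (codePoint t ω) (M / 2 ^ (n + 1))) ∧
      codeInc t η M n ω = Real.log 3 +
        Real.log (halvingPiece t η (ω 0) (closedBall (codePoint t ω) (M / 2 ^ (n + 1)))
          / η (closedBall (codePoint t ω) (M / 2 ^ (n + 1)))).toReal := by
  filter_upwards [hη.ae_codePoint
    (P := fun i x => ∀ r, 0 < r → 0 < halvingPiece t η i (closedBall x r))
    fun i => ae_measure_closedBall_pos _] with ω hω n
  have hr : 0 < M / 2 ^ (n + 1) := by positivity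
  have ha := hω _ hr
  refine ⟨ha, ?_⟩
  have hb := ha.trans_le (hη.halvingPiece_le _ _)
  have e : halvingPiece t η (ω 0) (closedBall (codePoint t ω) (M / 2 ^ (n + 1)))
      = 3⁻¹ * η (closedBall (codePoint t (seqShift ω)) (M / 2 ^ n)) := by
    rw [← halvingPiece_closedBall (t := t) (ω 0), ← codePoint_eq, pow_succ, div_div]
  have ha' : (halvingPiece t η (ω 0) (closedBall (codePoint t ω) (M / 2 ^ (n + 1)))).toReal ≠ 0 :=
    (ENNReal.toReal_pos ha.ne' (measure_ne_top _ _)).ne'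
  have hb' : (η (closedBall (codePoint t ω) (M / 2 ^ (n + 1)))).toReal ≠ 0 :=
    (ENNReal.toReal_pos hb.ne' (measure_ne_top _ _)).ne'
  rw [ENNReal.toReal_div, Real.log_div ha' hb']
  have e' := congrArg ENNReal.toReal e
  rw [ENNReal.toReal_mul, ENNReal.toReal_inv, ENNReal.toReal_ofNat] at e'
  have hc : (η (closedBall (codePoint t (seqShift ω)) (M / 2 ^ n))).toReal ≠ 0 := by
    intro h0; rw [h0, mul_zero] at e'; exact ha' e'
  have e2 := congrArg Real.log e'
  rw [Real.log_mul (by norm_num) hc, Real.log_inv] at e2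
  rw [codeInc, codeInfo, codeInfo, measureReal_def, measureReal_def, e2]
  ring

lemma IsHalvingMeasure.ae_codeInc_le [IsProbabilityMeasure η] (hη : IsHalvingMeasure t η) {M : ℝ}
    (hM : 0 < M) : ∀ᵐ ω ∂bernThree, ∀ n, codeInc t η M n ω ≤ Real.log 3 := by
  filter_upwards [hη.ae_codeInc_eq hM] with ω hω n
  obtain ⟨_, h⟩ := hω n
  rw [h]
  have : Real.log (halvingPiece t η (ω 0) (closedBall (codePoint t ω) (M / 2 ^ (n + 1)))
          / η (closedBall (codePoint t ω) (M / 2 ^ (n + 1)))).toReal ≤ 0 := by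
    refine Real.log_nonpos ENNReal.toReal_nonneg (ENNReal.toReal_le_of_le_ofReal zero_le_one ?_)
    rw [ENNReal.ofReal_one]
    exact ENNReal.div_le_of_le_mul (by simpa using hη.halvingPiece_le _ _)
  linarith

lemma IsHalvingMeasure.ae_tendsto_codeInc [IsProbabilityMeasure η] (hη : IsHalvingMeasure t η)
    {M : ℝ} (hM : 0 < M) :
    ∃ g' : (ℕ → Fin 3) → ℝ,
      ∀ᵐ ω ∂bernThree, Tendsto (fun n => codeInc t η M n ω) atTop (𝓝 (g' ω)) := by
  refine ⟨fun ω => Real.log 3 +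
    Real.log ((halvingPiece t η (ω 0)).rnDeriv η (codePoint t ω)).toReal, ?_⟩
  have hac : ∀ i, halvingPiece t η i ≪ η := fun i => Measure.absolutelyContinuous_of_le
    (hη.halvingPiece_le i)
  filter_upwards [hη.ae_codeInc_eq hM,
    hη.ae_codePoint (P := fun i x => 0 < (halvingPiece t η i).rnDeriv η x)
      fun i => Measure.rnDeriv_pos (hac i),
    hη.ae_codePoint (P := fun i x => (halvingPiece t η i).rnDeriv η x < ∞)
      fun i => (hac i).ae_le (Measure.rnDeriv_lt_top _ _),
    hη.ae_codePoint (P := fun i x =>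
      Tendsto (fun r => halvingPiece t η i (closedBall x r) / η (closedBall x r)) (𝓝[>] 0)
        (𝓝 ((halvingPiece t η i).rnDeriv η x)))
      fun i => (hac i).ae_le (Besicovitch.ae_tendsto_rnDeriv _ _)] with ω h1 h2 h3 h4
  have hr : Tendsto (fun n : ℕ => M / 2 ^ (n + 1)) atTop (𝓝[>] 0) := by
    refine tendsto_nhdsWithin_iff.2 ⟨?_, Eventually.of_forall fun n => by
      simp only [mem_Ioi]; positivity⟩
    have := (tendsto_pow_atTop_nhds_zero_of_lt_one (by norm_num : (0 : ℝ) ≤ 1 / 2)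
      (by norm_num)).const_mul M
    rw [mul_zero] at this
    refine ((tendsto_add_atTop_iff_nat 1).2 this).congr fun n => ?_
    rw [one_div, inv_pow, div_eq_mul_inv]
  have h5 := (Real.continuousAt_log (ENNReal.toReal_pos h2.ne' h3.ne).ne').tendsto.comp
    ((ENNReal.tendsto_toReal h3.ne).comp (h4.comp hr))
  exact (h5.const_add (Real.log 3)).congr fun n => (h1 n).2.symm

lemma IsHalvingMeasure.exists_integrable_bound [IsProbabilityMeasure η] (hη : IsHalvingMeasure t η)
    {M : ℝ} (hM : 0 < M) :
    ∃ G : (ℕ → Fin 3) → ℝ, Measurable G ∧ Integrable G bernThree ∧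
      ∀ᵐ ω ∂bernThree, ∀ n, |codeInc t η M n ω| ≤ G ω := by
  set H : (ℕ → Fin 3) → ℝ≥0∞ := fun ω => ⨆ n, ENNReal.ofReal (Real.log 3 - codeInc t η M n ω)
    with hHdef
  have hH : Measurable H := Measurable.iSup fun n =>
    (measurable_const.sub (measurable_codeInc M n)).ennreal_ofReal
  obtain ⟨K, hK⟩ := exists_measure_le_of_closedBall_le
  have htail : ∀ k : ℕ, bernThree {ω | (k : ℝ≥0∞) < H ω}
      ≤ 9 * K * ENNReal.ofReal (Real.exp (-1)) ^ k := by
    intro k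
    set s : ℝ≥0∞ := ENNReal.ofReal (Real.exp (-1)) ^ k with hs
    have hs' : s = ENNReal.ofReal (Real.exp (-k)) := by
      rw [hs, ← ENNReal.ofReal_pow (Real.exp_pos _).le, ← Real.exp_nat_mul]
      congr 2; ring
    set E : Fin 3 → Set ℝ := fun i => ⋃ n : ℕ,
      {x | halvingPiece t η i (closedBall x (M / 2 ^ (n + 1)))
      ≤ s * η (closedBall x (M / 2 ^ (n + 1)))} with hE
    have hEm : ∀ i, MeasurableSet (E i) := fun i => MeasurableSet.iUnion fun n =>
      measurableSet_le (measurable_measure_closedBall _ _)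
        ((measurable_measure_closedBall _ _).const_mul _)
    have hEle : ∀ i, halvingPiece t η i (E i) ≤ K * s := by
      intro i
      refine (hK (halvingPiece t η i) η s M (E i) fun x hx => ?_).trans_eq (by simp)
      obtain ⟨n, hn⟩ := mem_iUnion.1 hx
      exact ⟨_, by positivity, div_le_self hM.le (one_le_pow₀ one_le_two), hn⟩
    have hsub : ∀ᵐ ω ∂bernThree, (k : ℝ≥0∞) < H ω → codePoint t ω ∈ E (ω 0) := by
      filter_upwards [hη.ae_codeInc_eq hM] with ω hω hk
      obtain ⟨n, hn⟩ := lt_iSup_iff.1 hk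
      obtain ⟨ha, he⟩ := hω n
      refine mem_iUnion.2 ⟨n, ?_⟩
      set a := halvingPiece t η (ω 0) (closedBall (codePoint t ω) (M / 2 ^ (n + 1)))
      set b := η (closedBall (codePoint t ω) (M / 2 ^ (n + 1)))
      have hb : 0 < b := ha.trans_le (hη.halvingPiece_le _ _)
      have hafin : a ≠ ∞ := measure_ne_top _ _
      have hbfin : b ≠ ∞ := measure_ne_top _ _
      have hk' : (k : ℝ) < Real.log 3 - codeInc t η M n ω := by
        rw [← ENNReal.ofReal_natCast] at hn
        exact (ENNReal.ofReal_lt_ofReal_iff_of_nonneg (Nat.cast_nonneg k)).1 hn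
      rw [he] at hk'
      have habfin : a / b ≠ ∞ := ENNReal.div_ne_top hafin hb.ne'
      have hab : 0 < (a / b).toReal :=
        ENNReal.toReal_pos (ENNReal.div_pos ha.ne' hbfin).ne' habfin
      have hlt : (a / b).toReal < Real.exp (-k) := (Real.log_lt_iff_lt_exp hab).1 (by linarith)
      change a ≤ s * b
      rw [← ENNReal.div_le_iff_le_mul (Or.inl hb.ne') (Or.inl hbfin), hs',
        ← ENNReal.ofReal_toReal habfin]
      exact ENNReal.ofReal_le_ofReal hlt.le
    calc bernThree {ω | (k : ℝ≥0∞) < H ω} ≤ bernThree {ω | codePoint t ω ∈ E (ω 0)} :=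
          measure_mono_ae hsub
      _ ≤ ∑ i, 3 * halvingPiece t η i (E i) := hη.measure_codePoint_le hEm
      _ ≤ ∑ _i : Fin 3, 3 * (K * s) := Finset.sum_le_sum fun i _ => by gcongr; exact hEle i
      _ = 9 * K * s := by
          simp only [Finset.sum_const, Finset.card_univ, Fintype.card_fin, nsmul_eq_mul]
          push_cast; ring
  have hint : ∫⁻ ω, H ω ∂bernThree ≠ ∞ := by
    refine ne_top_of_le_ne_top ?_ ((lintegral_le_tsum_measure_lt hH).trans
      (ENNReal.tsum_le_tsum htail))
    rw [ENNReal.tsum_mul_left, ENNReal.tsum_geometric]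
    refine ENNReal.mul_ne_top (ENNReal.mul_ne_top (by simp) (by simp)) ?_
    rw [ENNReal.inv_ne_top]
    refine (tsub_pos_of_lt ?_).ne'
    rw [← ENNReal.ofReal_one]
    exact (ENNReal.ofReal_lt_ofReal_iff one_pos).2 (by rw [Real.exp_lt_one_iff]; norm_num)
  refine ⟨fun ω => Real.log 3 + (H ω).toReal, measurable_const.add hH.ennreal_toReal,
    (integrable_const _).add (integrable_toReal_of_lintegral_ne_top hH.aemeasurable hint), ?_⟩
  filter_upwards [hη.ae_codeInc_le hM, ae_lt_top hH hint] with ω h1 h2 n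
  have h3 : Real.log 3 - codeInc t η M n ω ≤ (H ω).toReal := by
    refine (ENNReal.ofReal_le_iff_le_toReal h2.ne).1 ?_
    exact le_iSup (fun n => ENNReal.ofReal (Real.log 3 - codeInc t η M n ω)) n
  have h4 : 0 ≤ Real.log 3 := Real.log_nonneg (by norm_num)
  have h5 := h1 n
  rw [abs_le]
  constructor <;> linarith [ENNReal.toReal_nonneg (a := H ω)]

/-- Halving measures are exact dimensional. -/
theorem IsHalvingMeasure.exists_ae_tendsto [IsProbabilityMeasure η] (hη : IsHalvingMeasure t η)
    {M : ℝ} (hM : 0 < M) (h0 : ∀ i, 0 ≤ t i) (h1 : ∀ i, t i ≤ M / 2) :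
    ∃ L : ℝ, 0 ≤ L ∧ ∀ᵐ x ∂η,
      Tendsto (fun n : ℕ => -Real.log (η.real (closedBall x (M / 2 ^ n))) / n) atTop (𝓝 L) := by
  obtain ⟨G, hGm, hG, hgG⟩ := hη.exists_integrable_bound hM
  obtain ⟨g', hg'⟩ := hη.ae_tendsto_codeInc hM
  have hIcc := hη.ae_mem_Icc h0 h1
  have hz : ∀ ω, codeInfo t η M 0 ω = 0 := by
    intro ω
    have : η.real (closedBall (codePoint t ω) (M / 2 ^ 0)) = 1 := by
      rw [measureReal_def, (mem_ae_iff_prob_eq_one measurableSet_closedBall).1, ENNReal.toReal_one]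
      filter_upwards [hIcc] with x hx
      have hc := codePoint_mem_Icc h0 h1 ω
      rw [mem_closedBall, Real.dist_eq, pow_zero, div_one, abs_le]
      constructor <;> linarith [hx.1, hx.2, hc.1, hc.2]
    rw [codeInfo, this, Real.log_one, neg_zero]
  have hlim := (ergodic_seqShift unifThree).ae_tendsto_cocycle_div (measurable_codeInc (t := t) M)
    hGm hG hgG hg' hz (fun n ω => by rw [codeInc]; ring)
  set L := ∫ ω, g' ω ∂bernThree
  have hx : ∀ᵐ x ∂η, Tendsto (fun n : ℕ => -Real.log (η.real (closedBall x (M / 2 ^ n))) / n)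
      atTop (𝓝 L) := by
    rw [← hη.map_codePoint]
    refine (ae_map_iff measurable_codePoint.aemeasurable ?_).2 ?_
    · exact measurableSet_tendsto _ fun n => ((Real.measurable_log.comp
        (measurable_measure_closedBall _ _).ennreal_toReal).neg).div_const _
    · rw [hη.map_codePoint]
      exact hlim
  refine ⟨L, ?_, hx⟩
  obtain ⟨x, hx⟩ := hx.exists
  refine ge_of_tendsto' hx fun n => div_nonneg (neg_nonneg.2 ?_) n.cast_nonneg
  exact Real.log_nonpos measureReal_nonneg measureReal_le_one

end ExactDimension

section Grid

/-- The `k`-th cell of the grid of mesh `ℓ`. -/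
def gridCell (ℓ : ℝ) (k : ℤ) : Set ℝ := {x | ⌊x / ℓ⌋ = k}

/-- The `k`-th cell of the grid of mesh `ℓ`, together with its two neighbours. -/
def gridNbhd (ℓ : ℝ) (k : ℤ) : Set ℝ := gridCell ℓ (k - 1) ∪ gridCell ℓ k ∪ gridCell ℓ (k + 1)

lemma measurableSet_gridCell (ℓ : ℝ) (k : ℤ) : MeasurableSet (gridCell ℓ k) :=
  (Int.measurable_floor.comp (measurable_id.div_const ℓ)) (measurableSet_singleton k)

lemma tsum_measure_gridCell (η : Measure ℝ) [IsProbabilityMeasure η] (ℓ : ℝ) :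
    ∑' k, η (gridCell ℓ k) = 1 := by
  rw [← measure_iUnion (fun i j hij => Set.disjoint_left.2 fun x hi hj => hij (hi.symm.trans hj))
    (measurableSet_gridCell ℓ)]
  rw [show ⋃ k, gridCell ℓ k = univ from eq_univ_of_forall fun x => mem_iUnion.2 ⟨_, rfl⟩,
    measure_univ]

lemma tsum_measure_gridNbhd_le (η : Measure ℝ) [IsProbabilityMeasure η] (ℓ : ℝ) :
    ∑' k, η (gridNbhd ℓ k) ≤ 3 := by
  have h1 : ∑' k, η (gridCell ℓ (k - 1)) = 1 := by
    rw [← tsum_measure_gridCell η ℓ]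
    exact (Equiv.subRight (1 : ℤ)).tsum_eq fun k => η (gridCell ℓ k)
  have h2 : ∑' k, η (gridCell ℓ (k + 1)) = 1 := by
    rw [← tsum_measure_gridCell η ℓ]
    exact (Equiv.addRight (1 : ℤ)).tsum_eq fun k => η (gridCell ℓ k)
  calc ∑' k, η (gridNbhd ℓ k)
      ≤ ∑' k, (η (gridCell ℓ (k - 1)) + η (gridCell ℓ k) + η (gridCell ℓ (k + 1))) :=
        ENNReal.tsum_le_tsum fun k => (measure_union_le _ _).trans
          (add_le_add_left (measure_union_le _ _) _)
    _ = 3 := by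
        rw [ENNReal.tsum_add, ENNReal.tsum_add, h1, h2, tsum_measure_gridCell]
        norm_num

variable {ℓ : ℝ} {k : ℤ} {x y : ℝ}

lemma mem_gridCell_iff (hℓ : 0 < ℓ) : x ∈ gridCell ℓ k ↔ k * ℓ ≤ x ∧ x < (k + 1) * ℓ := by
  rw [gridCell, mem_ofPred_eq, Int.floor_eq_iff, le_div_iff₀ hℓ, div_lt_iff₀ hℓ]

lemma mem_gridNbhd (hℓ : 0 < ℓ) (h1 : (k - 1) * ℓ ≤ x) (h2 : x < (k + 2) * ℓ) :
    x ∈ gridNbhd ℓ k := by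
  rcases lt_or_ge x (k * ℓ) with h | h
  · refine Or.inl (Or.inl ((mem_gridCell_iff hℓ).2 ?_))
    push_cast
    exact ⟨h1, by linarith⟩
  rcases lt_or_ge x ((k + 1) * ℓ) with h' | h'
  · exact Or.inl (Or.inr ((mem_gridCell_iff hℓ).2 ⟨h, h'⟩))
  · refine Or.inr ((mem_gridCell_iff hℓ).2 ?_)
    push_cast
    exact ⟨h', by linarith⟩

lemma closedBall_subset_gridNbhd (hℓ : 0 < ℓ) (hx : x ∈ gridCell ℓ k) :
    closedBall x ℓ ⊆ gridNbhd ℓ k := by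
  obtain ⟨h1, h2⟩ := (mem_gridCell_iff hℓ).1 hx
  intro y hy
  rw [mem_closedBall, Real.dist_eq, abs_le] at hy
  exact mem_gridNbhd hℓ (by linarith [hy.1]) (by linarith [hy.2])

lemma ediam_gridCell_le (hℓ : 0 < ℓ) : ediam (gridCell ℓ k) ≤ ENNReal.ofReal ℓ := by
  refine ediam_le fun x hx y hy => ?_
  obtain ⟨h1, h2⟩ := (mem_gridCell_iff hℓ).1 hx
  obtain ⟨h3, h4⟩ := (mem_gridCell_iff hℓ).1 hy
  rw [edist_dist, Real.dist_eq]
  refine ENNReal.ofReal_le_ofReal (abs_le.2 ?_)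
  constructor <;> linarith

end Grid

lemma measureDimH_le_one (η : Measure ℝ) [IsProbabilityMeasure η] : measureDimH η ≤ 1 :=
  sInf_le ⟨univ, measure_univ, Real.dimH_univ⟩

lemma le_dimH_of_measure_closedBall_le {η : Measure ℝ} {M : ℝ} (hM : 0 < M)
    {c : ℝ} (hc : 0 < c) {A B : Set ℝ} {N : ℕ}
    (hB : ∀ x ∈ B, ∀ n ≥ N,
      η (closedBall x (M / 2 ^ n)) ≤ ENNReal.ofReal (Real.exp (-(n * c))))
    (hBm : MeasurableSet B) (hAB : η (A ∩ B) ≠ 0) :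
    ENNReal.ofReal (c / Real.log 2) ≤ dimH A := by
  have hl2 : 0 < Real.log 2 := Real.log_pos one_lt_two
  have hd : 0 < c / Real.log 2 := div_pos hc hl2
  set d := c / Real.log 2 with hd'
  refine le_dimH_of_hausdorffMeasure_ne_zero (d := d.toNNReal) ?_
  rw [Real.coe_toNNReal _ hd.le]
  set C : ℝ := (2 / M) ^ d with hC
  have hC0 : 0 < C := by positivity
  have hexp : ∀ n : ℕ, Real.exp (-(n * c)) = C * (M / 2 ^ (n + 1)) ^ d := by
    intro n
    rw [hC, ← Real.mul_rpow (by positivity) (by positivity),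
      show 2 / M * (M / 2 ^ (n + 1)) = (2 ^ n)⁻¹ by field_simp; ring, Real.inv_rpow (by positivity),
      ← Real.rpow_natCast, ← Real.rpow_mul (by norm_num), Real.rpow_def_of_pos two_pos,
      Real.exp_neg, hd']
    congr 2
    field_simp
  have hr : Tendsto (fun n : ℕ => ENNReal.ofReal (Real.exp (-(n * c)))) atTop (𝓝 0) := by
    rw [← ENNReal.ofReal_zero]
    refine ENNReal.tendsto_ofReal (Real.tendsto_exp_neg_atTop_nhds_zero.comp ?_)
    exact tendsto_natCast_atTop_atTop.atTop_mul_const hc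
  have key : ∀ s : Set ℝ, ediam s ≤ ENNReal.ofReal (M / 2 ^ N) →
      ((ENNReal.ofReal C)⁻¹ • η.restrict B) s ≤ ediam s ^ d := by
    intro s hs
    rw [Measure.smul_apply, Measure.restrict_apply' hBm, smul_eq_mul,
      ENNReal.inv_mul_le_iff (by simpa using hC0) ENNReal.ofReal_ne_top]
    rcases (s ∩ B).eq_empty_or_nonempty with h | ⟨x, hxs, hxB⟩
    · rw [h, measure_empty]; exact zero_le
    have hfin : ediam s ≠ ∞ := ne_top_of_le_ne_top ENNReal.ofReal_ne_top hs
    have hsub : ∀ r : ℝ, ediam s ≤ ENNReal.ofReal r → 0 ≤ r → s ⊆ closedBall x r := by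
      intro r hr hr0 y hy
      rw [mem_closedBall]
      refine (ENNReal.ofReal_le_ofReal_iff hr0).1 ?_
      rw [← edist_dist]
      exact (edist_le_ediam_of_mem hy hxs).trans hr
    rcases (zero_le (a := ediam s)).eq_or_lt with h0 | h0
    · have : η (s ∩ B) ≤ 0 := by
        refine ge_of_tendsto hr ((eventually_ge_atTop N).mono fun n hn => ?_)
        refine (measure_mono (inter_subset_left.trans (hsub _ ?_ ?_))).trans (hB x hxB n hn)
        · rw [← h0]; exact zero_le
        · positivity
      exact this.trans zero_le
    · set δ := (ediam s).toReal with hδ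
      have hδ0 : 0 < δ := ENNReal.toReal_pos h0.ne' hfin
      have hδs : ediam s = ENNReal.ofReal δ := (ENNReal.ofReal_toReal hfin).symm
      have hδN : δ ≤ M / 2 ^ N := by
        rw [hδs] at hs
        exact (ENNReal.ofReal_le_ofReal_iff (by positivity)).1 hs
      obtain ⟨m, hm1, hm2⟩ := exists_nat_pow_near_of_lt_one
        (x := δ / (M / 2 ^ N)) (y := (1 / 2 : ℝ)) (by positivity)
        (div_le_one_of_le₀ hδN (by positivity)) (by norm_num) (by norm_num)
      have e1 : δ ≤ M / 2 ^ (N + m) := by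
        rw [div_le_iff₀ (by positivity)] at hm2
        refine hm2.trans_eq ?_
        rw [pow_add, one_div, inv_pow]; field_simp
      have e2 : M / 2 ^ (N + m + 1) ≤ δ := by
        rw [lt_div_iff₀ (by positivity)] at hm1
        refine hm1.le.trans_eq' ?_
        rw [add_assoc, pow_add, one_div, inv_pow]; field_simp; ring
      calc η (s ∩ B) ≤ η (closedBall x (M / 2 ^ (N + m))) :=
            measure_mono (inter_subset_left.trans (hsub _
              (hδs.trans_le (ENNReal.ofReal_le_ofReal e1)) (by positivity)))
        _ ≤ ENNReal.ofReal (Real.exp (-((N + m : ℕ) * c))) := hB x hxB _ (by omega)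
        _ ≤ ENNReal.ofReal C * ediam s ^ d := by
            rw [hδs, ENNReal.ofReal_rpow_of_pos hδ0, ← ENNReal.ofReal_mul hC0.le, hexp]
            refine ENNReal.ofReal_le_ofReal ?_
            gcongr
  have hle := Measure.le_hausdorffMeasure d _ _ (by simpa using by positivity) key
  have := hle A
  rw [Measure.smul_apply, Measure.restrict_apply' hBm, smul_eq_mul] at this
  intro h
  rw [h, nonpos_iff_eq_zero, mul_eq_zero, ENNReal.inv_eq_zero] at this
  exact this.elim ENNReal.ofReal_ne_top hAB

section LocalDim

variable {η : Measure ℝ} [IsProbabilityMeasure η] {M L : ℝ}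

lemma ae_eventually_le_measure_closedBall (hM : 0 < M)
    (h : ∀ᵐ x ∂η, Tendsto (fun n : ℕ => -Real.log (η.real (closedBall x (M / 2 ^ n))) / n)
      atTop (𝓝 L)) {c : ℝ} (hc : L < c) :
    ∀ᵐ x ∂η, ∀ᶠ n : ℕ in atTop,
      ENNReal.ofReal (Real.exp (-(n * c))) ≤ η (closedBall x (M / 2 ^ n)) := by
  filter_upwards [h, ae_measure_closedBall_pos η] with x hx hpos
  filter_upwards [hx.eventually (gt_mem_nhds hc), eventually_gt_atTop 0] with n hn hn0
  have hn0' : (0 : ℝ) < n := by exact_mod_cast hn0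
  have hp : 0 < η.real (closedBall x (M / 2 ^ n)) :=
    ENNReal.toReal_pos (hpos _ (by positivity)).ne' (measure_ne_top _ _)
  refine ENNReal.ofReal_le_of_le_toReal ?_
  rw [← measureReal_def, ← Real.le_log_iff_exp_le hp]
  rw [div_lt_iff₀ hn0'] at hn
  linarith

lemma ae_eventually_measure_closedBall_le (hM : 0 < M)
    (h : ∀ᵐ x ∂η, Tendsto (fun n : ℕ => -Real.log (η.real (closedBall x (M / 2 ^ n))) / n)
      atTop (𝓝 L)) {c : ℝ} (hc : c < L) :
    ∀ᵐ x ∂η, ∀ᶠ n : ℕ in atTop,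
      η (closedBall x (M / 2 ^ n)) ≤ ENNReal.ofReal (Real.exp (-(n * c))) := by
  filter_upwards [h, ae_measure_closedBall_pos η] with x hx hpos
  filter_upwards [hx.eventually (lt_mem_nhds hc), eventually_gt_atTop 0] with n hn hn0
  have hn0' : (0 : ℝ) < n := by exact_mod_cast hn0
  have hp : 0 < η.real (closedBall x (M / 2 ^ n)) :=
    ENNReal.toReal_pos (hpos _ (by positivity)).ne' (measure_ne_top _ _)
  rw [← ENNReal.ofReal_toReal (measure_ne_top η (closedBall x (M / 2 ^ n)))]
  refine ENNReal.ofReal_le_ofReal ?_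
  rw [← measureReal_def, ← Real.log_le_iff_le_exp hp]
  rw [lt_div_iff₀ hn0'] at hn
  linarith

lemma dimH_le_of_le_measure_closedBall (hM : 0 < M) {c : ℝ} (hc : 0 < c) {A : Set ℝ} {N : ℕ}
    (hA : ∀ x ∈ A, ∀ n ≥ N,
      ENNReal.ofReal (Real.exp (-(n * c))) ≤ η (closedBall x (M / 2 ^ n))) :
    dimH A ≤ ENNReal.ofReal (c / Real.log 2) := by
  have hl2 : 0 < Real.log 2 := Real.log_pos one_lt_two
  have hd : 0 < c / Real.log 2 := div_pos hc hl2
  set d := c / Real.log 2 with hd'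
  refine dimH_le_of_hausdorffMeasure_ne_top (d := d.toNNReal) ?_
  rw [Real.coe_toNNReal _ hd.le]
  have hr : Tendsto (fun n : ℕ => ENNReal.ofReal (M / 2 ^ n)) atTop (𝓝 0) := by
    rw [← ENNReal.ofReal_zero]
    refine ENNReal.tendsto_ofReal ?_
    have := (tendsto_pow_atTop_nhds_zero_of_lt_one (by norm_num : (0 : ℝ) ≤ 1 / 2)
      (by norm_num)).const_mul M
    rw [mul_zero] at this
    exact this.congr fun n => by rw [one_div, inv_pow, div_eq_mul_inv]
  have hpos : ∀ n : ℕ, 0 < M / 2 ^ n := fun n => by positivity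
  have hpow : ∀ n : ℕ, ENNReal.ofReal (M / 2 ^ n) ^ d
      = ENNReal.ofReal (M ^ d) * ENNReal.ofReal (Real.exp (-(n * c))) := by
    intro n
    rw [ENNReal.ofReal_rpow_of_pos (hpos n), ← ENNReal.ofReal_mul (by positivity)]
    congr 1
    rw [Real.div_rpow hM.le (by positivity), div_eq_mul_inv, Real.exp_neg, ← Real.rpow_natCast,
      ← Real.rpow_mul (by norm_num), Real.rpow_def_of_pos two_pos, hd']
    congr 3
    field_simp
  have hbound : ∀ n ≥ N, ∑' k : ℤ, ediam (gridCell (M / 2 ^ n) k ∩ A) ^ d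
      ≤ ENNReal.ofReal (M ^ d) * 3 := by
    intro n hn
    calc ∑' k : ℤ, ediam (gridCell (M / 2 ^ n) k ∩ A) ^ d
        ≤ ∑' k : ℤ, ENNReal.ofReal (M ^ d) * η (gridNbhd (M / 2 ^ n) k) := by
          refine ENNReal.tsum_le_tsum fun k => ?_
          rcases (gridCell (M / 2 ^ n) k ∩ A).eq_empty_or_nonempty with h | ⟨x, hx, hxA⟩
          · rw [h, ediam_empty, ENNReal.zero_rpow_of_pos hd]
            exact zero_le
          · calc ediam (gridCell (M / 2 ^ n) k ∩ A) ^ d ≤ ENNReal.ofReal (M / 2 ^ n) ^ d := by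
                  gcongr
                  exact (ediam_mono inter_subset_left).trans (ediam_gridCell_le (hpos n))
              _ = ENNReal.ofReal (M ^ d) * ENNReal.ofReal (Real.exp (-(n * c))) := hpow n
              _ ≤ ENNReal.ofReal (M ^ d) * η (gridNbhd (M / 2 ^ n) k) := by
                  gcongr
                  exact (hA x hxA n hn).trans
                    (measure_mono (closedBall_subset_gridNbhd (hpos n) hx))
      _ = ENNReal.ofReal (M ^ d) * ∑' k : ℤ, η (gridNbhd (M / 2 ^ n) k) := ENNReal.tsum_mul_left
      _ ≤ _ := by gcongr; exact tsum_measure_gridNbhd_le _ _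
  have hH := Measure.hausdorffMeasure_le_liminf_tsum d A (l := atTop) _ hr
    (fun n k => gridCell (M / 2 ^ n) k ∩ A)
    (Eventually.of_forall fun n k => (ediam_mono inter_subset_left).trans
      (ediam_gridCell_le (hpos n)))
    (Eventually.of_forall fun n x hx => mem_iUnion.2 ⟨_, rfl, hx⟩)
  refine ne_top_of_le_ne_top ?_ (hH.trans (liminf_le_of_frequently_le'
    (((eventually_ge_atTop N).mono hbound).frequently)))
  exact ENNReal.mul_ne_top ENNReal.ofReal_ne_top (by simp)

/-- A measure whose local dimension is almost everywhere `L / log 2` has that dimension. -/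
theorem measureDimH_eq_of_ae_tendsto (hM : 0 < M) (hL : 0 ≤ L)
    (h : ∀ᵐ x ∂η, Tendsto (fun n : ℕ => -Real.log (η.real (closedBall x (M / 2 ^ n))) / n)
      atTop (𝓝 L)) :
    measureDimH η = ENNReal.ofReal (L / Real.log 2) := by
  have hl2 : 0 < Real.log 2 := Real.log_pos one_lt_two
  refine le_antisymm ?_ ?_
  · have hall : ∀ᵐ x ∂η, ∀ j : ℕ, ∀ᶠ n : ℕ in atTop,
        ENNReal.ofReal (Real.exp (-(n * (L + 1 / (j + 1))))) ≤ η (closedBall x (M / 2 ^ n)) :=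
      ae_all_iff.2 fun j => ae_eventually_le_measure_closedBall hM h
        (lt_add_of_pos_right _ Nat.one_div_pos_of_nat)
    obtain ⟨A, hAsub, hAm, hA⟩ := exists_measurable_superset_of_null (ae_iff.1 hall)
    have hA1 : η Aᶜ = 1 := (prob_compl_eq_one_iff hAm).2 hA
    have hinf : measureDimH η ≤ dimH Aᶜ := sInf_le ⟨_, hA1, rfl⟩
    refine hinf.trans ?_
    have hj : ∀ j : ℕ, dimH Aᶜ ≤ ENNReal.ofReal ((L + 1 / (j + 1)) / Real.log 2) := by
      intro j
      have hsub : Aᶜ ⊆ ⋃ N : ℕ, {x | ∀ n ≥ N,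
          ENNReal.ofReal (Real.exp (-(n * (L + 1 / (j + 1))))) ≤ η (closedBall x (M / 2 ^ n))} := by
        intro x hx
        have : ∀ j : ℕ, ∀ᶠ n : ℕ in atTop,
            ENNReal.ofReal (Real.exp (-(n * (L + 1 / (j + 1)))))
              ≤ η (closedBall x (M / 2 ^ n)) := by
          by_contra hcon
          exact hx (hAsub hcon)
        obtain ⟨N, hN⟩ := eventually_atTop.1 (this j)
        exact mem_iUnion.2 ⟨N, hN⟩
      refine (dimH_mono hsub).trans ?_
      rw [dimH_iUnion]
      exact iSup_le fun N => dimH_le_of_le_measure_closedBall hM (by positivity) fun x hx => hx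
    have hlim : Tendsto (fun j : ℕ => ENNReal.ofReal ((L + 1 / (j + 1)) / Real.log 2)) atTop
        (𝓝 (ENNReal.ofReal (L / Real.log 2))) := by
      refine ENNReal.tendsto_ofReal ?_
      have := ((tendsto_one_div_add_atTop_nhds_zero_nat (𝕜 := ℝ)).const_add L).div_const
        (Real.log 2)
      simpa using this
    exact ge_of_tendsto' hlim hj
  · refine le_sInf ?_
    rintro _ ⟨A, hA, rfl⟩
    have hc : ∀ c, 0 < c → c < L → ENNReal.ofReal (c / Real.log 2) ≤ dimH A := by
      intro c hc0 hcL
      set B : ℕ → Set ℝ := fun N => ⋂ n ≥ N,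
        {x | η (closedBall x (M / 2 ^ n)) ≤ ENNReal.ofReal (Real.exp (-(n * c)))} with hB
      have hBm : ∀ N, MeasurableSet (B N) := fun N => MeasurableSet.iInter fun n =>
        MeasurableSet.iInter fun _ =>
          measurableSet_le (measurable_measure_closedBall _ _) measurable_const
      have hU : η (⋃ N, A ∩ B N) ≠ 0 := by
        intro h0
        have h1 : η (⋃ N, B N)ᶜ = 0 := by
          refine measure_mono_null ?_ (ae_iff.1 (ae_eventually_measure_closedBall_le hM h hcL))
          intro x hx hcon
          obtain ⟨N, hN⟩ := eventually_atTop.1 hcon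
          exact hx (mem_iUnion.2 ⟨N, mem_iInter₂.2 hN⟩)
        have h2 : η A ≤ 0 := by
          refine (measure_mono ?_).trans ((measure_union_le (⋃ N, A ∩ B N) (⋃ N, B N)ᶜ).trans ?_)
          · intro x hx
            rw [← inter_iUnion]
            by_cases hxB : x ∈ ⋃ N, B N
            · exact Or.inl ⟨hx, hxB⟩
            · exact Or.inr hxB
          · rw [h0, h1, add_zero]
        rw [hA] at h2
        exact absurd h2 (by simp)
      obtain ⟨N, hN⟩ := exists_measure_pos_of_not_measure_iUnion_null hU
      exact le_dimH_of_measure_closedBall_le hM hc0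
        (fun x hx n hn => mem_iInter₂.1 hx n hn) (hBm N) hN.ne'
    rcases hL.eq_or_lt with h0 | h0
    · rw [← h0]; simp
    · have hlim : Tendsto (fun c : ℝ => ENNReal.ofReal (c / Real.log 2)) (𝓝[<] L)
          (𝓝 (ENNReal.ofReal (L / Real.log 2))) :=
        ENNReal.tendsto_ofReal ((tendsto_id.div_const _).mono_left nhdsWithin_le_nhds)
      refine le_of_tendsto hlim ?_
      filter_upwards [Ioo_mem_nhdsLT h0] with c hc'
      exact hc c hc'.1 hc'.2

end LocalDim

section Words

/-- The translation part of the composition of the maps `x ↦ (1 / 2) • x + t i` along a word. -/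
def wordSum {E : Type*} [AddCommGroup E] [Module ℝ E] (t : Fin 3 → E) {n : ℕ} (u : Fin n → Fin 3) :
    E :=
  ∑ k : Fin n, ((1 / 2 : ℝ) ^ (k : ℕ)) • t (u k)

lemma wordSum_cons {E : Type*} [AddCommGroup E] [Module ℝ E] (t : Fin 3 → E) {n : ℕ} (i : Fin 3)
    (u : Fin n → Fin 3) :
    wordSum t (Fin.cons i u : Fin (n + 1) → Fin 3) = t i + (1 / 2 : ℝ) • wordSum t u := by
  simp [wordSum, Fin.sum_univ_succ, Finset.smul_sum, smul_smul, pow_succ, mul_comm]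

/-- The number of words of length `n` whose cylinder interval contains `x`. -/
def wordCount (t : Fin 3 → ℝ) (M : ℝ) (n : ℕ) (x : ℝ) : ℕ :=
  (Finset.univ.filter fun u : Fin n → Fin 3 =>
    x ∈ Icc (wordSum t u) (wordSum t u + M / 2 ^ n)).card

lemma measurable_wordCount (t : Fin 3 → ℝ) (M : ℝ) (n : ℕ) : Measurable (wordCount t M n) := by
  have : wordCount t M n = fun x => ∑ u : Fin n → Fin 3,
      (Icc (wordSum t u) (wordSum t u + M / 2 ^ n)).indicator 1 x := by
    ext x
    simp only [wordCount, Finset.card_filter, indicator_apply, Pi.one_apply]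
  rw [this]
  exact Finset.measurable_fun_sum _ fun u _ => measurable_one.indicator measurableSet_Icc

variable {t : Fin 3 → ℝ} {η : Measure ℝ}

lemma IsHalvingMeasure.eq_sum_words (hη : IsHalvingMeasure t η) (n : ℕ) :
    η = ((3 : ℝ≥0∞)⁻¹) ^ n • ∑ u : Fin n → Fin 3, η.map fun x => x / 2 ^ n + wordSum t u := by
  induction n with
  | zero => simp [wordSum]
  | succ n ih =>
    have hm : ∀ c d : ℝ, Measurable fun x : ℝ => x / c + d := fun c d => by fun_prop
    have hsplit : ∀ i, η.map (fun x => x / 2 + t i) = ((3 : ℝ≥0∞)⁻¹) ^ n • ∑ u : Fin n → Fin 3,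
        η.map fun x => x / 2 ^ (n + 1) + wordSum t (Fin.cons i u : Fin (n + 1) → Fin 3) := by
      intro i
      conv_lhs => rw [ih, Measure.map_smul, Measure.map_finset_sum' (by fun_prop)]
      congr 1
      refine Finset.sum_congr rfl fun u _ => ?_
      rw [Measure.map_map (hm _ _) (hm _ _)]
      congr 1
      ext x
      simp only [Function.comp_apply, wordSum_cons, smul_eq_mul, pow_succ]
      field_simp
      ring
    conv_lhs => rw [hη]
    simp only [hsplit]
    rw [← Finset.smul_sum, smul_smul, ← pow_succ']
    congr 1
    rw [← Fintype.sum_prod_type' (f := fun i (u : Fin n → Fin 3) =>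
      η.map fun x => x / 2 ^ (n + 1) + wordSum t (Fin.cons i u : Fin (n + 1) → Fin 3))]
    exact Fintype.sum_equiv (Fin.consEquiv fun _ => Fin 3) _ _ fun _ => rfl

lemma IsHalvingMeasure.measure_eq_sum_words (hη : IsHalvingMeasure t η) (n : ℕ) {A : Set ℝ}
    (hA : MeasurableSet A) :
    η A = ((3 : ℝ≥0∞)⁻¹) ^ n *
      ∑ u : Fin n → Fin 3, η ((fun x => x / 2 ^ n + wordSum t u) ⁻¹' A) := by
  conv_lhs => rw [hη.eq_sum_words n]
  rw [Measure.smul_apply, Measure.finsetSum_apply, smul_eq_mul]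
  congr 1
  exact Finset.sum_congr rfl fun u _ => Measure.map_apply (by fun_prop) hA

variable [IsProbabilityMeasure η] {M : ℝ}

lemma IsHalvingMeasure.wordCount_le (hη : IsHalvingMeasure t η) (hη0 : ∀ᵐ x ∂η, x ∈ Icc 0 M)
    (n : ℕ) (x : ℝ) :
    (wordCount t M n x : ℝ≥0∞) ≤ 3 ^ n * η (closedBall x (M / 2 ^ n)) := by
  rw [hη.measure_eq_sum_words n measurableSet_closedBall, ← mul_assoc, ← mul_pow,
    ENNReal.mul_inv_cancel (by simp) (by simp), one_pow, one_mul, wordCount,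
    Finset.card_filter, Nat.cast_sum]
  refine Finset.sum_le_sum fun u _ => ?_
  split_ifs with h
  · rw [Nat.cast_one, ← (mem_ae_iff_prob_eq_one (measurableSet_Icc)).1 hη0]
    refine measure_mono fun y hy => ?_
    have h1 : y / 2 ^ n ≤ M / 2 ^ n := by gcongr; exact hy.2
    have h2 : 0 ≤ y / 2 ^ n := div_nonneg hy.1 (by positivity)
    rw [mem_preimage, mem_closedBall, Real.dist_eq, abs_le]
    constructor <;> linarith [h.1, h.2]
  · simp

lemma measure_word_preimage_le (hη0 : ∀ᵐ x ∂η, x ∈ Icc 0 M) {n : ℕ} (u : Fin n → Fin 3)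
    (S : Set ℝ) :
    η ((fun x => x / 2 ^ n + wordSum t u) ⁻¹' S)
      ≤ if (Icc (wordSum t u) (wordSum t u + M / 2 ^ n) ∩ S).Nonempty then 1 else 0 := by
  split_ifs with h
  · exact prob_le_one
  · rw [nonpos_iff_eq_zero]
    have h0 : η {y | ¬ y ∈ Icc 0 M} = 0 := ae_iff.1 hη0
    refine measure_mono_null (fun y hy => ?_) h0
    intro hyI
    refine h ⟨_, ?_, hy⟩
    have h1 : y / 2 ^ n ≤ M / 2 ^ n := by gcongr; exact hyI.2
    have h2 : 0 ≤ y / 2 ^ n := div_nonneg hyI.1 (by positivity)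
    constructor <;> linarith

lemma card_words_meeting_cell_le (hM : 0 < M) {n : ℕ} {A : Set ℝ} {K : ℝ≥0∞}
    {k : ℤ} (hA : ∀ x ∈ A ∩ gridCell (M / 2 ^ n) k, (wordCount t M n x : ℝ≥0∞) ≤ K) :
    ((Finset.univ.filter fun u : Fin n → Fin 3 =>
      (Icc (wordSum t u) (wordSum t u + M / 2 ^ n) ∩ (A ∩ gridCell (M / 2 ^ n) k)).Nonempty).card
        : ℝ≥0∞) ≤ 2 * K := by
  set ℓ := M / 2 ^ n with hℓ
  have hℓ0 : 0 < ℓ := by positivity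
  set V := Finset.univ.filter fun u : Fin n → Fin 3 =>
      (Icc (wordSum t u) (wordSum t u + ℓ) ∩ (A ∩ gridCell ℓ k)).Nonempty with hV
  have hch : ∀ u ∈ V, ∃ a, a ∈ Icc (wordSum t u) (wordSum t u + ℓ) ∧ a ∈ A ∩ gridCell ℓ k :=
    fun u hu => (Finset.mem_filter.1 hu).2
  choose! a haI haA using hch
  have hcell := fun u hu => (mem_gridCell_iff hℓ0).1 (haA u hu).2
  have hpart : ∀ W ⊆ V, (∃ v ∈ V, ∀ u ∈ W, a v ∈ Icc (wordSum t u) (wordSum t u + ℓ)) →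
      (W.card : ℝ≥0∞) ≤ K := by
    rintro W - ⟨v, hv, h⟩
    refine le_trans ?_ (hA _ (haA v hv))
    exact_mod_cast Finset.card_le_card fun u hu => Finset.mem_filter.2 ⟨Finset.mem_univ _, h u hu⟩
  have h1 : ((V.filter fun u => k * ℓ ≤ wordSum t u).card : ℝ≥0∞) ≤ K := by
    set W := V.filter fun u => k * ℓ ≤ wordSum t u with hW
    rcases W.eq_empty_or_nonempty with h | h
    · rw [h]; simp
    obtain ⟨v, hv, hmax⟩ := W.exists_max_image a h
    have hvV := (Finset.mem_filter.1 hv).1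
    refine hpart W (Finset.filter_subset _ _) ⟨v, hvV, fun u hu => ?_⟩
    obtain ⟨huV, hk⟩ := Finset.mem_filter.1 hu
    exact ⟨(haI u huV).1.trans (hmax u hu), by linarith [(hcell v hvV).2]⟩
  have h2 : ((V.filter fun u => ¬ k * ℓ ≤ wordSum t u).card : ℝ≥0∞) ≤ K := by
    set W := V.filter fun u => ¬ k * ℓ ≤ wordSum t u with hW
    rcases W.eq_empty_or_nonempty with h | h
    · rw [h]; simp
    obtain ⟨v, hv, hmin⟩ := W.exists_min_image a h
    have hvV := (Finset.mem_filter.1 hv).1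
    refine hpart W (Finset.filter_subset _ _) ⟨v, hvV, fun u hu => ?_⟩
    obtain ⟨huV, hk⟩ := Finset.mem_filter.1 hu
    exact ⟨by linarith [(hcell v hvV).1], (hmin u hu).trans (haI u huV).2⟩
  rw [← Finset.card_filter_add_card_filter_not (s := V) (fun u => k * ℓ ≤ wordSum t u), two_mul,
    Nat.cast_add]
  exact add_le_add h1 h2

lemma IsHalvingMeasure.measure_wordCount_le (hη : IsHalvingMeasure t η)
    (hη0 : ∀ᵐ x ∂η, x ∈ Icc 0 M) (hM : 0 < M) (n : ℕ) (s : ℝ≥0∞) :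
    η {x | (wordCount t M n x : ℝ≥0∞) ≤ s * (3 ^ n * η (closedBall x (M / 2 ^ n)))} ≤ 6 * s := by
  set ℓ := M / 2 ^ n with hℓ
  have hℓ0 : 0 < ℓ := by positivity
  set A := {x | (wordCount t M n x : ℝ≥0∞) ≤ s * (3 ^ n * η (closedBall x ℓ))} with hA
  have hAm : MeasurableSet A := measurableSet_le
    (measurable_from_nat.comp (measurable_wordCount t M n))
    (((measurable_measure_closedBall η ℓ).const_mul _).const_mul _)
  have hk : ∀ k : ℤ, η (A ∩ gridCell ℓ k) ≤ 2 * s * η (gridNbhd ℓ k) := by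
    intro k
    have hcard := card_words_meeting_cell_le (t := t) (n := n) (A := A) (k := k) hM
      (K := s * (3 ^ n * η (gridNbhd ℓ k))) fun x hx => by
        refine le_trans (b := s * (3 ^ n * η (closedBall x ℓ))) hx.1 ?_
        gcongr
        exact closedBall_subset_gridNbhd hℓ0 hx.2
    rw [hη.measure_eq_sum_words n (hAm.inter (measurableSet_gridCell ℓ k))]
    calc ((3 : ℝ≥0∞)⁻¹) ^ n *
          ∑ u : Fin n → Fin 3, η ((fun x => x / 2 ^ n + wordSum t u) ⁻¹' (A ∩ gridCell ℓ k))
        ≤ ((3 : ℝ≥0∞)⁻¹) ^ n * (2 * (s * (3 ^ n * η (gridNbhd ℓ k)))) := by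
          gcongr
          refine (Finset.sum_le_sum fun u _ => measure_word_preimage_le hη0 u _).trans ?_
          rw [← Finset.natCast_card_filter]
          exact hcard
      _ = (((3 : ℝ≥0∞)⁻¹) * 3) ^ n * (2 * s * η (gridNbhd ℓ k)) := by rw [mul_pow]; ring
      _ = 2 * s * η (gridNbhd ℓ k) := by
          rw [ENNReal.inv_mul_cancel (by simp) (by simp), one_pow, one_mul]
  calc η A ≤ η (⋃ k : ℤ, A ∩ gridCell ℓ k) :=
        measure_mono fun x hx => mem_iUnion.2 ⟨_, hx, rfl⟩
    _ ≤ ∑' k : ℤ, η (A ∩ gridCell ℓ k) := measure_iUnion_le _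
    _ ≤ ∑' k : ℤ, 2 * s * η (gridNbhd ℓ k) := ENNReal.tsum_le_tsum hk
    _ = 2 * s * ∑' k : ℤ, η (gridNbhd ℓ k) := ENNReal.tsum_mul_left
    _ ≤ 2 * s * 3 := by gcongr; exact tsum_measure_gridNbhd_le _ _
    _ = 6 * s := by ring

lemma IsHalvingMeasure.ae_eventually_lt_wordCount (hη : IsHalvingMeasure t η)
    (hη0 : ∀ᵐ x ∂η, x ∈ Icc 0 M) (hM : 0 < M) {δ : ℝ} (hδ : 0 < δ) :
    ∀ᵐ x ∂η, ∀ᶠ n : ℕ in atTop,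
      ENNReal.ofReal (Real.exp (-(n * δ))) * (3 ^ n * η (closedBall x (M / 2 ^ n)))
        < wordCount t M n x := by
  have hsum : ∑' n : ℕ, η {x | (wordCount t M n x : ℝ≥0∞)
      ≤ ENNReal.ofReal (Real.exp (-(n * δ))) * (3 ^ n * η (closedBall x (M / 2 ^ n)))} ≠ ∞ := by
    refine ne_top_of_le_ne_top ?_ (ENNReal.tsum_le_tsum fun n =>
      hη.measure_wordCount_le hη0 hM n (ENNReal.ofReal (Real.exp (-(n * δ)))))
    have he : ∀ n : ℕ, ENNReal.ofReal (Real.exp (-(n * δ)))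
        = ENNReal.ofReal (Real.exp (-δ)) ^ n := by
      intro n
      rw [← ENNReal.ofReal_pow (Real.exp_pos _).le, ← Real.exp_nat_mul]
      congr 2; ring
    simp only [he]
    rw [ENNReal.tsum_mul_left, ENNReal.tsum_geometric]
    refine ENNReal.mul_ne_top (by simp) ?_
    rw [ENNReal.inv_ne_top]
    refine (tsub_pos_of_lt ?_).ne'
    rw [← ENNReal.ofReal_one]
    exact (ENNReal.ofReal_lt_ofReal_iff one_pos).2 (by rw [Real.exp_lt_one_iff]; linarith)
  filter_upwards [ae_eventually_notMem hsum] with x hx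
  filter_upwards [hx] with n hn
  exact not_le.1 hn

/-- Almost everywhere, the number of cylinders above a point grows like `exp (n (log 3 - L))`,
where `L / log 2` is the local dimension. -/
theorem IsHalvingMeasure.ae_tendsto_log_wordCount (hη : IsHalvingMeasure t η)
    (hη0 : ∀ᵐ x ∂η, x ∈ Icc 0 M) (hM : 0 < M) {L : ℝ}
    (h : ∀ᵐ x ∂η, Tendsto (fun n : ℕ => -Real.log (η.real (closedBall x (M / 2 ^ n))) / n)
      atTop (𝓝 L)) :
    ∀ᵐ x ∂η, (∀ᶠ n in atTop, 0 < wordCount t M n x) ∧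
      Tendsto (fun n : ℕ => Real.log (wordCount t M n x) / n) atTop (𝓝 (Real.log 3 - L)) := by
  have e3 : ∀ n : ℕ, (3 : ℝ≥0∞) ^ n = ENNReal.ofReal (Real.exp (n * Real.log 3)) := by
    intro n
    rw [Real.exp_nat_mul, Real.exp_log (by norm_num), ENNReal.ofReal_pow (by norm_num)]
    simp
  have hup := fun k : ℕ => ae_eventually_measure_closedBall_le hM h
    (sub_lt_self L (Nat.one_div_pos_of_nat (n := k)))
  have hlo := fun k : ℕ => ae_eventually_le_measure_closedBall hM h
    (lt_add_of_pos_right L (half_pos (Nat.one_div_pos_of_nat (n := k))))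
  have hbc := fun k : ℕ => hη.ae_eventually_lt_wordCount hη0 hM
    (half_pos (Nat.one_div_pos_of_nat (n := k)))
  filter_upwards [ae_all_iff.2 hup, ae_all_iff.2 hlo, ae_all_iff.2 hbc] with x h1 h2 h3
  have hpos : ∀ᶠ n in atTop, 0 < wordCount t M n x := by
    filter_upwards [h3 0] with n hn
    exact_mod_cast zero_le.trans_lt hn
  refine ⟨hpos, tendsto_div_natCast_of_eventually_le (fun k => ?_) (fun k => ?_)⟩
  · filter_upwards [hpos, h1 k] with n hp hn
    have hp' : (0 : ℝ) < wordCount t M n x := by exact_mod_cast hp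
    rw [Real.log_le_iff_le_exp hp', ← ENNReal.ofReal_le_ofReal_iff (Real.exp_pos _).le,
      ENNReal.ofReal_natCast]
    refine (hη.wordCount_le hη0 n x).trans ?_
    calc 3 ^ n * η (closedBall x (M / 2 ^ n))
        ≤ ENNReal.ofReal (Real.exp (n * Real.log 3))
          * ENNReal.ofReal (Real.exp (-(n * (L - 1 / (k + 1))))) := by rw [e3]; gcongr
      _ = _ := by
        rw [← ENNReal.ofReal_mul (Real.exp_pos _).le, ← Real.exp_add]
        congr 2; ring
  · filter_upwards [hpos, h2 k, h3 k] with n hp hn hn'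
    have hp' : (0 : ℝ) < wordCount t M n x := by exact_mod_cast hp
    rw [neg_le, Real.le_log_iff_exp_le hp', ← ENNReal.ofReal_le_ofReal_iff hp'.le,
      ENNReal.ofReal_natCast]
    refine le_trans ?_ hn'.le
    calc ENNReal.ofReal (Real.exp (-(n * (-(Real.log 3 - L) + 1 / (k + 1)))))
        = ENNReal.ofReal (Real.exp (-(n * (1 / (k + 1) / 2))))
          * (ENNReal.ofReal (Real.exp (n * Real.log 3))
          * ENNReal.ofReal (Real.exp (-(n * (L + 1 / (k + 1) / 2))))) := by
          rw [← ENNReal.ofReal_mul (Real.exp_pos _).le, ← Real.exp_add,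
            ← ENNReal.ofReal_mul (Real.exp_pos _).le, ← Real.exp_add]
          congr 2; ring
      _ ≤ _ := by rw [e3]; gcongr

end Words

section WordCode

lemma map_wordSum {E F : Type*} [AddCommGroup E] [Module ℝ E] [AddCommGroup F] [Module ℝ F]
    (φ : E →ₗ[ℝ] F) (t : Fin 3 → E) {n : ℕ} (u : Fin n → Fin 3) :
    φ (wordSum t u) = wordSum (fun i => φ (t i)) u := by
  simp [wordSum]

/-- The integer whose binary digits mark the occurrences of the symbol `j` in a word. -/
def wordCode (j : Fin 3) {n : ℕ} (u : Fin n → Fin 3) : ℕ :=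
  ∑ k : Fin n, if u k = j then 2 ^ (k.rev : ℕ) else 0

lemma wordCode_cons (j i : Fin 3) {n : ℕ} (u : Fin n → Fin 3) :
    wordCode j (Fin.cons i u : Fin (n + 1) → Fin 3) =
      (if i = j then 2 ^ n else 0) + wordCode j u := by
  simp [wordCode, Fin.sum_univ_succ]

lemma wordCode_lt (j : Fin 3) {n : ℕ} (u : Fin n → Fin 3) : wordCode j u < 2 ^ n := by
  induction n with
  | zero => simp [wordCode]
  | succ n ih =>
    rw [← Fin.cons_self_tail u, wordCode_cons, pow_succ]
    have := ih (Fin.tail u)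
    split_ifs <;> omega

lemma eq_of_wordCode_eq {n : ℕ} {u v : Fin n → Fin 3} (h1 : wordCode 1 u = wordCode 1 v)
    (h2 : wordCode 2 u = wordCode 2 v) : u = v := by
  induction n with
  | zero => exact Subsingleton.elim _ _
  | succ n ih =>
    rw [← Fin.cons_self_tail u, ← Fin.cons_self_tail v] at h1 h2 ⊢
    generalize u 0 = i at *
    generalize v 0 = j at *
    generalize Fin.tail u = u at *
    generalize Fin.tail v = v at *
    have a1 := wordCode_lt 1 u
    have a2 := wordCode_lt 2 u
    have b1 := wordCode_lt 1 v
    have b2 := wordCode_lt 2 v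
    simp only [wordCode_cons] at h1 h2
    have hij : i = j := by
      fin_cases i <;> fin_cases j <;> simp at h1 h2 ⊢ <;> omega
    subst hij
    rw [ih (u := u) (v := v) (Nat.add_left_cancel h1) (Nat.add_left_cancel h2)]

end WordCode

section Gasket

/-- The translation parts of the maps of the gasket. -/
def gasketShift : Fin 3 → ℝ × ℝ := ![(0, 0), (1 / 2, 0), (1 / 4, Real.sqrt 3 / 4)]

lemma gasketMap_eq (i : Fin 3) (z : ℝ × ℝ) : gasketMap i z = (1 / 2 : ℝ) • z + gasketShift i := by
  fin_cases i <;> ext <;> simp [gasketMap, gasketShift] <;> ring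

lemma wordSum_gasketShift {n : ℕ} (u : Fin n → Fin 3) :
    wordSum gasketShift u = ((1 / 2 : ℝ) ^ n) •
      ((wordCode 1 u + wordCode 2 u / 2, Real.sqrt 3 / 2 * wordCode 2 u) : ℝ × ℝ) := by
  induction n with
  | zero => ext <;> simp [wordSum, wordCode]
  | succ n ih =>
    rw [← Fin.cons_self_tail u, wordSum_cons, ih]
    simp only [wordCode_cons]
    generalize u 0 = i
    have h : ((1 / 2 : ℝ)) ^ n * 2 ^ n = 1 := by rw [← mul_pow]; norm_num
    rw [one_div, inv_pow] at h
    fin_cases i <;> ext <;> simp [gasketShift, pow_succ]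
    · ring
    · ring
    · linear_combination (-1 / 2) * h
    · ring
    · linear_combination (-1 / 4) * h
    · linear_combination (-√3 / 4) * h

variable {Δ : Set (ℝ × ℝ)}

lemma IsSierpinskiGasket.mem_iff (hΔ : IsSierpinskiGasket Δ) {z : ℝ × ℝ} :
    z ∈ Δ ↔ ∃ i, ∃ w ∈ Δ, z = (1 / 2 : ℝ) • w + gasketShift i := by
  conv_lhs => rw [hΔ.2.2]
  simp only [mem_union, mem_image, gasketMap_eq, Fin.exists_fin_succ, IsEmpty.exists_iff, or_false,
    eq_comm (a := z), or_assoc]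
  rfl

lemma IsSierpinskiGasket.mem_iff_word (hΔ : IsSierpinskiGasket Δ) (n : ℕ) {z : ℝ × ℝ} :
    z ∈ Δ ↔ ∃ u : Fin n → Fin 3, ∃ w ∈ Δ, z = ((1 / 2 : ℝ) ^ n) • w + wordSum gasketShift u := by
  induction n generalizing z with
  | zero => simp [wordSum]
  | succ n ih =>
    rw [hΔ.mem_iff]
    constructor
    · rintro ⟨i, w, hw, rfl⟩
      obtain ⟨u, w', hw', rfl⟩ := ih.1 hw
      refine ⟨Fin.cons i u, w', hw', ?_⟩
      rw [wordSum_cons, pow_succ', mul_smul, smul_add]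
      abel
    · rintro ⟨u, w, hw, rfl⟩
      refine ⟨u 0, _, ih.2 ⟨Fin.tail u, w, hw, rfl⟩, ?_⟩
      conv_lhs => rw [← Fin.cons_self_tail u]
      rw [wordSum_cons, pow_succ', mul_smul, smul_add]
      abel

lemma IsSierpinskiGasket.apply_mem_Icc (hΔ : IsSierpinskiGasket Δ) (φ : ℝ × ℝ →ₗ[ℝ] ℝ) {M : ℝ}
    (hφ : ∀ i, φ (gasketShift i) ∈ Icc 0 (M / 2)) {z : ℝ × ℝ} (hz : z ∈ Δ) : φ z ∈ Icc 0 M := by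
  have hc : ContinuousOn φ Δ := φ.continuous_of_finiteDimensional.continuousOn
  obtain ⟨x, hx, hmin⟩ := hΔ.2.1.exists_isMinOn hΔ.1 hc
  obtain ⟨y, hy, hmax⟩ := hΔ.2.1.exists_isMaxOn hΔ.1 hc
  obtain ⟨i, x', hx', hi⟩ := hΔ.mem_iff.1 hx
  obtain ⟨j, y', hy', hj⟩ := hΔ.mem_iff.1 hy
  have hi' := congrArg φ hi
  have hj' := congrArg φ hj
  rw [map_add, map_smul, smul_eq_mul] at hi' hj'
  have h1 : φ x ≤ φ x' := hmin hx'
  have h2 : φ y' ≤ φ y := hmax hy'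
  have h3 : φ x ≤ φ z := hmin hz
  have h4 : φ z ≤ φ y := hmax hz
  constructor <;> linarith [(hφ i).1, (hφ j).2]

lemma IsSierpinskiGasket.Icc_subset_image (hΔ : IsSierpinskiGasket Δ) (φ : ℝ × ℝ →ₗ[ℝ] ℝ) {M : ℝ}
    {i j : Fin 3} (hi : φ (gasketShift i) = 0) (hj : φ (gasketShift j) = M / 2) :
    Icc 0 M ⊆ φ '' Δ := by
  set K := φ '' Δ with hK
  have hne : K.Nonempty := hΔ.1.image _
  have hcpt : IsCompact K := hΔ.2.1.image φ.continuous_of_finiteDimensional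
  have hstep : ∀ k, ∀ y, infDist (y / 2 + φ (gasketShift k)) K ≤ infDist y K / 2 := by
    intro k y
    obtain ⟨_, ⟨w, hw, rfl⟩, hd⟩ := hcpt.exists_infDist_eq_dist hne y
    rw [hd]
    have hm : φ ((1 / 2 : ℝ) • w + gasketShift k) ∈ K :=
      mem_image_of_mem _ (hΔ.mem_iff.2 ⟨k, w, hw, rfl⟩)
    refine (infDist_le_dist_of_mem hm).trans (le_of_eq ?_)
    rw [map_add, map_smul, smul_eq_mul, dist_add_right, Real.dist_eq, Real.dist_eq,
      ← abs_of_pos (two_pos (α := ℝ)), ← abs_div, abs_of_pos (two_pos (α := ℝ))]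
    congr 1; ring
  obtain ⟨D, hD⟩ : BddAbove ((fun y => infDist y K) '' Icc 0 M) :=
    (isCompact_Icc.image (continuous_infDist_pt K)).bddAbove
  have hle : ∀ n : ℕ, ∀ x ∈ Icc 0 M, infDist x K ≤ D * (1 / 2) ^ n := by
    intro n
    induction n with
    | zero => intro x hx; simpa using hD (mem_image_of_mem _ hx)
    | succ n ih =>
      intro x hx
      obtain ⟨k, y, hy, rfl⟩ : ∃ k, ∃ y ∈ Icc 0 M, x = y / 2 + φ (gasketShift k) := by
        rcases le_total x (M / 2) with h | h
        · exact ⟨i, 2 * x, ⟨by linarith [hx.1], by linarith⟩, by rw [hi]; ring⟩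
        · exact ⟨j, 2 * x - M, ⟨by linarith, by linarith [hx.2]⟩, by rw [hj]; ring⟩
      refine (hstep k y).trans ?_
      rw [pow_succ]
      linarith [ih y hy]
  intro x hx
  rw [hcpt.isClosed.mem_iff_infDist_zero hne]
  refine le_antisymm ?_ infDist_nonneg
  have hlim := (tendsto_pow_atTop_nhds_zero_of_lt_one (r := (1 / 2 : ℝ)) (by norm_num)
    (by norm_num)).const_mul D
  rw [mul_zero] at hlim
  exact ge_of_tendsto' hlim fun n => hle n x hx

lemma IsSierpinskiGasket.norm_le (hΔ : IsSierpinskiGasket Δ) {z : ℝ × ℝ} (hz : z ∈ Δ) :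
    ‖z‖ ≤ 1 := by
  have hs : Real.sqrt 3 ≤ 2 := Real.sqrt_le_iff.2 ⟨by norm_num, by norm_num⟩
  have hs0 := Real.sqrt_nonneg 3
  have h1 := hΔ.apply_mem_Icc (LinearMap.fst ℝ ℝ ℝ) (M := 1)
    (fun i => by fin_cases i <;> norm_num [gasketShift]) hz
  have h2 := hΔ.apply_mem_Icc (LinearMap.snd ℝ ℝ ℝ) (M := 1)
    (fun i => by fin_cases i <;> constructor <;> simp [gasketShift] <;> linarith) hz
  rw [norm_prod_le_iff, Real.norm_eq_abs, Real.norm_eq_abs, abs_le, abs_le]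
  rw [LinearMap.fst_apply] at h1
  rw [LinearMap.snd_apply] at h2
  exact ⟨⟨by linarith [h1.1], h1.2⟩, ⟨by linarith [h2.1], h2.2⟩⟩

end Gasket

section Slices

/-- `projAngle θ` as a linear map. -/
def projAngleLin (θ : ℝ) : ℝ × ℝ →ₗ[ℝ] ℝ :=
  Real.cos θ • LinearMap.fst ℝ ℝ ℝ + Real.sin θ • LinearMap.snd ℝ ℝ ℝ

lemma projAngleLin_apply (θ : ℝ) (z : ℝ × ℝ) : projAngleLin θ z = projAngle θ z := by
  simp [projAngleLin, projAngle, mul_comm]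

lemma measurable_projAngle (θ : ℝ) : Measurable (projAngle θ) := by
  unfold projAngle; fun_prop

variable {Δ : Set (ℝ × ℝ)} {ν : Measure (ℝ × ℝ)}

lemma IsGasketMeasure.isHalvingMeasure_map (hν : IsGasketMeasure Δ ν) (θ : ℝ) :
    IsHalvingMeasure (fun i => projAngle θ (gasketShift i)) (ν.map (projAngle θ)) := by
  have hm : ∀ i, Measurable (gasketMap i) := fun i => by
    rw [funext (gasketMap_eq i)]; fun_prop
  have h : ∀ i, (ν.map (gasketMap i)).map (projAngle θ)
      = (ν.map (projAngle θ)).map fun x => x / 2 + projAngle θ (gasketShift i) := by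
    intro i
    rw [Measure.map_map (measurable_projAngle θ) (hm i),
      Measure.map_map (measurable_halving _) (measurable_projAngle θ)]
    congr 1
    ext z
    simp only [Function.comp_apply, gasketMap_eq, ← projAngleLin_apply, map_add, map_smul,
      smul_eq_mul]
    ring
  unfold IsHalvingMeasure
  conv_lhs => rw [hν.2.2, Measure.map_smul, Measure.map_add _ _ (measurable_projAngle θ),
    Measure.map_add _ _ (measurable_projAngle θ)]
  rw [Fin.sum_univ_three, h, h, h]

/-- A slice is covered by one ball for each cylinder of order `n` which it meets. -/
lemma IsSierpinskiGasket.coverNum_slice_le (hΔ : IsSierpinskiGasket Δ) {θ M : ℝ}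
    (ht : ∀ i, projAngle θ (gasketShift i) ∈ Icc 0 (M / 2)) (a : ℝ) {n : ℕ} {ε : ℝ}
    (hε : (1 / 2) ^ n < ε) :
    coverNum (sliceSet Δ θ a) ε ≤ wordCount (fun i => projAngle θ (gasketShift i)) M n a := by
  set V := Finset.univ.filter fun u : Fin n → Fin 3 =>
    a ∈ Icc (wordSum (fun i => projAngle θ (gasketShift i)) u)
      (wordSum (fun i => projAngle θ (gasketShift i)) u + M / 2 ^ n) with hV
  refine le_trans (Nat.sInf_le ⟨V.image (wordSum gasketShift), rfl, ?_⟩) Finset.card_image_le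
  rintro z ⟨hz, hza⟩
  obtain ⟨u, w, hw, rfl⟩ := (hΔ.mem_iff_word n).1 hz
  have hwM : projAngle θ w ∈ Icc 0 M := by
    rw [← projAngleLin_apply]
    exact hΔ.apply_mem_Icc _ (fun i => by rw [projAngleLin_apply]; exact ht i) hw
  rw [← projAngleLin_apply, map_add, map_smul, map_wordSum, smul_eq_mul] at hza
  simp only [projAngleLin_apply] at hza
  refine mem_iUnion₂.2 ⟨_, Finset.mem_image_of_mem _ (Finset.mem_filter.2
    ⟨Finset.mem_univ u, ?_⟩), ?_⟩
  · have h1 : (1 / 2 : ℝ) ^ n * projAngle θ w ≤ M / 2 ^ n := by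
      rw [one_div, inv_pow, div_eq_inv_mul]; gcongr; exact hwM.2
    have h2 : 0 ≤ (1 / 2 : ℝ) ^ n * projAngle θ w := mul_nonneg (by positivity) hwM.1
    constructor <;> linarith
  · rw [mem_ball, dist_eq_norm, add_sub_cancel_right, norm_smul, Real.norm_eq_abs,
      abs_of_pos (by positivity)]
    exact (mul_le_of_le_one_right (by positivity) (hΔ.norm_le hw)).trans_lt hε

lemma abs_wordCode_sub_lt {n : ℕ} {u v : Fin n → Fin 3}
    (h : dist (wordSum gasketShift u) (wordSum gasketShift v) < 4 * (1 / 2) ^ n) {j : Fin 3}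
    (hj : j ≠ 0) : |(wordCode j u : ℝ) - wordCode j v| < 8 := by
  have hp : (0 : ℝ) < (1 / 2) ^ n := by positivity
  rw [dist_eq_norm, wordSum_gasketShift, wordSum_gasketShift, ← smul_sub, norm_smul,
    Real.norm_eq_abs, abs_of_pos hp, mul_comm, mul_lt_mul_iff_left₀ hp, Prod.norm_def, max_lt_iff,
    Prod.fst_sub, Prod.snd_sub, Real.norm_eq_abs, Real.norm_eq_abs, abs_lt, abs_lt] at h
  obtain ⟨⟨h1, h2⟩, h3, h4⟩ := h
  have hs : 1 ≤ Real.sqrt 3 := Real.one_le_sqrt.2 (by norm_num)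
  dsimp only at h1 h2 h3 h4
  have h5 : |(wordCode 2 u : ℝ) - wordCode 2 v| < 8 := by
    have : |Real.sqrt 3 * ((wordCode 2 u : ℝ) - wordCode 2 v)| < 8 := by
      rw [abs_lt]; constructor <;> linarith
    rw [abs_mul, abs_of_nonneg (by positivity)] at this
    nlinarith [abs_nonneg ((wordCode 2 u : ℝ) - wordCode 2 v)]
  fin_cases j
  · exact absurd rfl hj
  · rw [abs_lt] at h5 ⊢
    constructor <;> simp <;> linarith
  · exact h5

lemma eq_of_abs_sub_lt_of_mod_eq {a b : ℕ} (h : |(a : ℝ) - b| < 8) (hm : a % 8 = b % 8) :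
    a = b := by
  have : |(a : ℤ) - b| < 8 := by exact_mod_cast h
  rw [abs_lt] at this
  omega

/-- A ball of radius at most `2⁻ⁿ` is close to boundedly many cylinders of order `n`. -/
lemma IsSierpinskiGasket.wordCount_le_coverNum (hΔ : IsSierpinskiGasket Δ) {θ M : ℝ}
    {i j : Fin 3}
    (hi : projAngle θ (gasketShift i) = 0) (hj : projAngle θ (gasketShift j) = M / 2) (a : ℝ)
    {n : ℕ} {ε : ℝ} (hε0 : 0 < ε) (hε : ε ≤ (1 / 2) ^ n) :
    wordCount (fun i => projAngle θ (gasketShift i)) M n a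
      ≤ 64 * coverNum (sliceSet Δ θ a) ε := by
  set V := Finset.univ.filter fun u : Fin n → Fin 3 =>
    a ∈ Icc (wordSum (fun i => projAngle θ (gasketShift i)) u)
      (wordSum (fun i => projAngle θ (gasketShift i)) u + M / 2 ^ n) with hV
  have hne : {N : ℕ | ∃ F : Finset (ℝ × ℝ), F.card = N ∧
      sliceSet Δ θ a ⊆ ⋃ x ∈ F, ball x ε}.Nonempty := by
    obtain ⟨F, -, hF, hcov⟩ := hΔ.2.1.finite_cover_balls hε0
    refine ⟨_, hF.toFinset, rfl, ?_⟩
    simp only [Finite.mem_toFinset]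
    exact fun z hz => hcov hz.1
  obtain ⟨F, hFc, hF⟩ := Nat.sInf_mem hne
  have hx : ∀ u ∈ V, ∃ x ∈ F, dist (wordSum gasketShift u) x < 2 * (1 / 2) ^ n := by
    intro u hu
    have hu' := (Finset.mem_filter.1 hu).2
    have hp : (0 : ℝ) < 2 ^ n := by positivity
    obtain ⟨w, hw, hwa⟩ := hΔ.Icc_subset_image (projAngleLin θ) (M := M)
      (by rw [projAngleLin_apply]; exact hi) (by rw [projAngleLin_apply]; exact hj)
      (show (a - wordSum (fun i => projAngle θ (gasketShift i)) u) * 2 ^ n ∈ Icc 0 M from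
        ⟨mul_nonneg (by linarith [hu'.1]) hp.le, by
          rw [← le_div_iff₀ hp]; linarith [hu'.2]⟩)
    have hz : (1 / 2 : ℝ) ^ n • w + wordSum gasketShift u ∈ sliceSet Δ θ a := by
      refine ⟨(hΔ.mem_iff_word n).2 ⟨u, w, hw, rfl⟩, ?_⟩
      rw [← projAngleLin_apply, map_add, map_smul, map_wordSum, hwa, smul_eq_mul, one_div, inv_pow]
      simp only [projAngleLin_apply]
      field_simp
      ring
    obtain ⟨x, hxF, hzx⟩ := mem_iUnion₂.1 (hF hz)
    refine ⟨x, hxF, ?_⟩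
    have hd : dist (wordSum gasketShift u) ((1 / 2 : ℝ) ^ n • w + wordSum gasketShift u)
        ≤ (1 / 2) ^ n := by
      rw [dist_comm, dist_eq_norm, add_sub_cancel_right, norm_smul, Real.norm_eq_abs,
        abs_of_pos (by positivity)]
      exact mul_le_of_le_one_right (by positivity) (hΔ.norm_le hw)
    linarith [dist_triangle (wordSum gasketShift u) ((1 / 2 : ℝ) ^ n • w + wordSum gasketShift u) x,
      mem_ball.1 hzx]
  choose! x hxF hxd using hx
  have hcard := Finset.card_le_card_of_injOn (s := V)
    (t := F ×ˢ (Finset.range 8 ×ˢ Finset.range 8))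
    (fun u => (x u, wordCode 1 u % 8, wordCode 2 u % 8))
    (fun u hu => by
      simp only [Finset.coe_product, mem_prod, Finset.mem_coe, Finset.mem_range]
      exact ⟨hxF u hu, Nat.mod_lt _ (by norm_num), Nat.mod_lt _ (by norm_num)⟩)
    (fun u hu v hv huv => by
      obtain ⟨h0, h1, h2⟩ : x u = x v ∧ wordCode 1 u % 8 = wordCode 1 v % 8 ∧
        wordCode 2 u % 8 = wordCode 2 v % 8 := by simpa using huv
      have hd : dist (wordSum gasketShift u) (wordSum gasketShift v) < 4 * (1 / 2) ^ n := by
        have e1 := hxd u hu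
        have e2 := hxd v hv
        rw [h0] at e1
        linarith [dist_triangle_right (wordSum gasketShift u) (wordSum gasketShift v) (x v)]
      exact eq_of_wordCode_eq
        (eq_of_abs_sub_lt_of_mod_eq (abs_wordCode_sub_lt hd (by decide)) h1)
        (eq_of_abs_sub_lt_of_mod_eq (abs_wordCode_sub_lt hd (by decide)) h2))
  rw [Finset.card_product, Finset.card_product, Finset.card_range, hFc] at hcard
  rw [mul_comm]
  exact hcard

end Slices

section BoxDimension

/-- Passing from dyadic scales to all scales. -/
lemma tendsto_log_div_log_of_dyadic {N : ℝ → ℕ} {w : ℕ → ℕ} {C : ℕ} (hC : 0 < C) {κ : ℝ}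
    (hpos : ∀ᶠ n in atTop, 0 < w n)
    (hw : Tendsto (fun n : ℕ => Real.log (w n) / n) atTop (𝓝 κ))
    (hlow : ∀ (n : ℕ) (ε : ℝ), 0 < ε → ε ≤ (1 / 2) ^ n → w n ≤ C * N ε)
    (hup : ∀ (n : ℕ) (ε : ℝ), (1 / 2) ^ n < ε → N ε ≤ w n) :
    Tendsto (fun ε : ℝ => Real.log (N ε) / Real.log (1 / ε)) (𝓝[>] 0)
      (𝓝 (κ / Real.log 2)) := by
  have hl2 : 0 < Real.log 2 := Real.log_pos (by norm_num)
  set y : ℝ → ℝ := fun ε => Real.log (1 / ε) / Real.log 2 with hy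
  have hlog : Tendsto (fun ε : ℝ => Real.log (1 / ε)) (𝓝[>] 0) atTop := by
    simp only [one_div]
    exact Real.tendsto_log_atTop.comp tendsto_inv_nhdsGT_zero
  have hyt : Tendsto y (𝓝[>] 0) atTop := hlog.atTop_div_const hl2
  have hn : Tendsto (fun ε => ⌊y ε⌋₊) (𝓝[>] 0) atTop := tendsto_nat_floor_atTop.comp hyt
  have hn1 : Tendsto (fun ε => ⌊y ε⌋₊ + 1) (𝓝[>] 0) atTop := (tendsto_add_atTop_nat 1).comp hn
  have hny : Tendsto (fun ε => (⌊y ε⌋₊ : ℝ) / y ε) (𝓝[>] 0) (𝓝 1) :=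
    (tendsto_nat_floor_div_atTop (R := ℝ)).comp hyt
  have hinv : Tendsto (fun ε => (y ε)⁻¹) (𝓝[>] 0) (𝓝 0) := tendsto_inv_atTop_zero.comp hyt
  have hlo : Tendsto (fun ε => (Real.log (w ⌊y ε⌋₊) / ⌊y ε⌋₊ * (⌊y ε⌋₊ / y ε)
      - Real.log C * (y ε)⁻¹) / Real.log 2) (𝓝[>] 0) (𝓝 (κ / Real.log 2)) := by
    simpa using (((hw.comp hn).mul hny).sub (hinv.const_mul (Real.log C))).div_const (Real.log 2)
  have hhi : Tendsto (fun ε => (Real.log (w (⌊y ε⌋₊ + 1)) / (⌊y ε⌋₊ + 1 : ℕ) *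
      (⌊y ε⌋₊ / y ε + (y ε)⁻¹)) / Real.log 2) (𝓝[>] 0) (𝓝 (κ / Real.log 2)) := by
    simpa using ((hw.comp hn1).mul (hny.add hinv)).div_const (Real.log 2)
  refine tendsto_of_tendsto_of_tendsto_of_le_of_le' hlo hhi ?_ ?_
  all_goals
    filter_upwards [hn.eventually hpos, hn.eventually (eventually_gt_atTop 0),
      hyt.eventually (eventually_gt_atTop 0), self_mem_nhdsWithin] with ε hw0 hn0 hy0 hε
    have hn0' : (0 : ℝ) < ⌊y ε⌋₊ := by exact_mod_cast hn0
    have hε0 : 0 < ε := hε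
    have he : ∀ k : ℝ, Real.exp (-(k * Real.log 2)) < ε ↔ y ε < k := by
      intro k
      rw [← Real.lt_log_iff_exp_lt hε0, hy]
      simp only [one_div, Real.log_inv]
      rw [div_lt_iff₀ hl2, neg_lt]
    have hpow : ∀ k : ℕ, ((1 / 2 : ℝ)) ^ k = Real.exp (-(k * Real.log 2)) := by
      intro k
      rw [← mul_neg, ← Real.log_inv, Real.exp_nat_mul, Real.exp_log (by norm_num), one_div]
    have h1 : ε ≤ (1 / 2) ^ ⌊y ε⌋₊ := by
      rw [hpow, ← not_lt, he, not_lt]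
      exact Nat.floor_le hy0.le
    have h2 : (1 / 2) ^ (⌊y ε⌋₊ + 1) < ε := by
      rw [hpow, he]
      exact_mod_cast Nat.lt_floor_add_one (y ε)
    have hlow' := hlow _ ε hε0 h1
    have hup' := hup _ ε h2
    have hN : 0 < N ε := Nat.pos_of_mul_pos_left (hw0.trans_le hlow')
    have hN' : (0 : ℝ) < N ε := by exact_mod_cast hN
    have hC' : (0 : ℝ) < C := by exact_mod_cast hC
    have hyl : Real.log (1 / ε) = y ε * Real.log 2 := by simp only [hy]; field_simp
    rw [hyl, ← div_div]
  · gcongr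
    have : Real.log (w ⌊y ε⌋₊) ≤ Real.log C + Real.log (N ε) := by
      rw [← Real.log_mul hC'.ne' hN'.ne']
      exact Real.log_le_log (by exact_mod_cast hw0) (by exact_mod_cast hlow')
    calc _ = (Real.log (w ⌊y ε⌋₊) - Real.log C) / y ε := by field_simp
      _ ≤ _ := by gcongr; linarith
  · gcongr
    have : Real.log (N ε) ≤ Real.log (w (⌊y ε⌋₊ + 1)) :=
      Real.log_le_log hN' (by exact_mod_cast hup')
    calc _ ≤ Real.log (w (⌊y ε⌋₊ + 1)) / y ε := by gcongr
      _ = _ := by push_cast; field_simp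

end BoxDimension

/-- **Corollary.** For every `θ ∈ (0, π/3)` and `ν_θ`-almost every `a ∈ Δ_θ`, the box
dimension of `E_{θ,a}` exists and equals `s - dim_H ν_θ ≥ s - 1`. -/
theorem gasket_slice_boxDim_ae_eq_s_sub_dimH_measure
    (Δ : Set (ℝ × ℝ)) (hΔ : IsSierpinskiGasket Δ)
    (ν : Measure (ℝ × ℝ)) (hν : IsGasketMeasure Δ ν)
    (θ : ℝ) (hθ : θ ∈ Set.Ioo 0 (Real.pi / 3)) :
    ∀ᵐ a ∂(ν.map (projAngle θ)),
      lowerBoxDim (sliceSet Δ θ a) = upperBoxDim (sliceSet Δ θ a) ∧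
      upperBoxDim (sliceSet Δ θ a)
        = Real.log 3 / Real.log 2 - (measureDimH (ν.map (projAngle θ))).toReal ∧
      Real.log 3 / Real.log 2 - 1 ≤ upperBoxDim (sliceSet Δ θ a) := by
  have := hν.1
  have hc : 0 < Real.cos θ := Real.cos_pos_of_mem_Ioo
    ⟨by linarith [hθ.1, Real.pi_pos], by linarith [hθ.2, Real.pi_pos]⟩
  have hs : 0 < Real.sin θ := Real.sin_pos_of_pos_of_lt_pi hθ.1
    (by linarith [hθ.2, Real.pi_pos])
  set η := ν.map (projAngle θ) with hη
  have : IsProbabilityMeasure η :=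
    Measure.isProbabilityMeasure_map (measurable_projAngle θ).aemeasurable
  set t : Fin 3 → ℝ := fun i => projAngle θ (gasketShift i) with ht
  have ht0 : t 0 = 0 := by simp [ht, projAngle, gasketShift]
  have ht1 : 0 < t 1 := by simpa [ht, projAngle, gasketShift] using hc
  have ht2 : 0 < t 2 := by simp only [ht, projAngle, gasketShift]; simp; positivity
  obtain ⟨j, hj⟩ := Finite.exists_max t
  set M := 2 * t j with hMdef
  have hjM : t j = M / 2 := by rw [hMdef]; ring
  have hM : 0 < M := by linarith [hj 1]
  have h0 : ∀ i, 0 ≤ t i := by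
    intro i; fin_cases i
    exacts [ht0.ge, ht1.le, ht2.le]
  have h1 : ∀ i, t i ≤ M / 2 := fun i => hjM ▸ hj i
  have hself : IsHalvingMeasure t η := hν.isHalvingMeasure_map θ
  obtain ⟨L, hL0, hL⟩ := hself.exists_ae_tendsto hM h0 h1
  have hdim : measureDimH η = ENNReal.ofReal (L / Real.log 2) :=
    measureDimH_eq_of_ae_tendsto hM hL0 hL
  have hl2 : 0 < Real.log 2 := Real.log_pos (by norm_num)
  have hdim' : (measureDimH η).toReal = L / Real.log 2 := by
    rw [hdim, ENNReal.toReal_ofReal (div_nonneg hL0 hl2.le)]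
  have hle : (measureDimH η).toReal ≤ 1 :=
    ENNReal.toReal_le_of_le_ofReal zero_le_one (by simpa using measureDimH_le_one η)
  filter_upwards [hself.ae_tendsto_log_wordCount (hself.ae_mem_Icc h0 h1) hM hL] with a ha
  have hlim := tendsto_log_div_log_of_dyadic (by norm_num : 0 < 64) ha.1 ha.2
    (fun n ε => hΔ.wordCount_le_coverNum ht0 hjM a)
    (fun n ε => hΔ.coverNum_slice_le (fun i => ⟨h0 i, h1 i⟩) a)
  have hup : upperBoxDim (sliceSet Δ θ a) = Real.log 3 / Real.log 2 - (measureDimH η).toReal := by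
    rw [hdim', ← sub_div]
    exact hlim.limsup_eq
  refine ⟨hlim.liminf_eq.trans hlim.limsup_eq.symm, hup, ?_⟩
  rw [hup]
  linarith

end
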